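/- Fix a constant ε > 0 and consider any p = p_n ∈ [0,1/2] satisfying p ≥ (1+ε)·(log n)/n. For any sequence of graphs G_0 = G_0(n) on the vertex set {1,…,n}, with G_rand ∼ G(n,p), with high probability the stable colouring R*σ of the graph G = G_0 △ G_rand assigns pairwise distinct colours to all n vertices. -/

import Mathlib

open MeasureTheory Filter

/-- Product of (independent) Bernoulli distributions on `ι → Bool`, with
success probability `q i` in coordinate `i`. -/
noncomputable def bernoulliProduct (ι : Type*) [Fintype ι] [DecidableEq ι] (q : ι → ℝ) :
    Measure (ι → Bool) :=
  ∑ f : ι → Bool,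
    (∏ i : ι, if f i then ENNReal.ofReal (q i) else ENNReal.ofReal (1 - q i)) •
      Measure.dirac f

/-- The Erdős–Rényi measure: each (potential) edge of the complete graph on `Fin n`
is present independently with probability `p`; encoded as a random `Sym2 (Fin n) → Bool`. -/
noncomputable def erdosRenyiMeasure (n : ℕ) (p : ℝ) : Measure (Sym2 (Fin n) → Bool) :=
  bernoulliProduct (Sym2 (Fin n)) fun _ => p

/-- The graph on `Fin n` determined by an edge-indicator function. -/
def graphOfFlip {n : ℕ} (f : Sym2 (Fin n) → Bool) : SimpleGraph (Fin n) :=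
  SimpleGraph.fromRel fun u v => f s(u, v) = true

/-- Symmetric difference of two graphs on the same vertex set. -/
def symmDiffG {V : Type*} (G₁ G₂ : SimpleGraph V) : SimpleGraph V :=
  SimpleGraph.fromRel fun u v => Xor' (G₁.Adj u v) (G₂.Adj u v)

/-- `crEquiv G c t u v` : vertices `u` and `v` get the same colour after `t` rounds of
colour refinement on `G`, starting from the colouring `c`. -/
def crEquiv {V : Type*} {Ω : Type*} (G : SimpleGraph V) (c : V → Ω) : ℕ → V → V → Prop
  | 0, u, v => c u = c v
  | (t + 1), u, v => crEquiv G c t u v ∧ ∀ w : V,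
      Nat.card {x : V // G.Adj u x ∧ crEquiv G c t x w} =
      Nat.card {x : V // G.Adj v x ∧ crEquiv G c t x w}

/-- `u` and `v` get the same colour in the stable colouring `R* c`. -/
def crStable {V : Type*} {Ω : Type*} (G : SimpleGraph V) (c : V → Ω) (u v : V) : Prop :=
  ∀ t, crEquiv G c t u v

/-- `u` and `v` get the same colour in the stable colouring `R* σ`
(colour refinement started from the trivial colouring). -/
def crStableTrivial {V : Type*} (G : SimpleGraph V) (u v : V) : Prop :=
  crStable G (fun _ => (0 : ℕ)) u v

/-- Equality of the initial pair-colourings `φ_{G,c}` on two ordered pairs of vertices. -/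
def wl2Init {V : Type*} {Ω : Type*} (G : SimpleGraph V) (c : V → Ω) (p q : V × V) : Prop :=
  (G.Adj p.1 p.2 ↔ G.Adj q.1 q.2) ∧ (p.1 = p.2 ↔ q.1 = q.2) ∧
    (p.1 = p.2 → q.1 = q.2 → c p.2 = c q.2)

/-- `wl2Equiv G c t p q` : the ordered pairs `p` and `q` get the same colour after `t` rounds of
the 2-dimensional Weisfeiler–Leman refinement on `G`, started from `φ_{G,c}`. -/
def wl2Equiv {V : Type*} {Ω : Type*} (G : SimpleGraph V) (c : V → Ω) :
    ℕ → V × V → V × V → Prop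
  | 0, p, q => wl2Init G c p q
  | (t + 1), p, q => wl2Equiv G c t p q ∧ ∀ r s : V × V,
      Nat.card {w : V // wl2Equiv G c t (p.1, w) r ∧ wl2Equiv G c t (w, p.2) s} =
      Nat.card {w : V // wl2Equiv G c t (q.1, w) r ∧ wl2Equiv G c t (w, q.2) s}

/-- `u` and `v` get the same colour in the vertex colouring `V* c` obtained from the stable
pair colouring of the 2-dimensional Weisfeiler–Leman algorithm started from `φ_{G,c}`. -/
def wl2VertexEquiv {V : Type*} {Ω : Type*} (G : SimpleGraph V) (c : V → Ω) (u v : V) : Prop :=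
  ∀ t, wl2Equiv G c t (u, u) (v, v)

/-- Given a colouring of `V(H)` encoded as the equivalence relation `r` ("has the same colour"),
`majority H r u v` says that at least half of the possible edges between the colour class of `u`
and the colour class of `v` are present in `H` (counting ordered pairs). -/
def majority {V : Type*} (H : SimpleGraph V) (r : V → V → Prop) (u v : V) : Prop :=
  Nat.card {p : V × V // p.1 ≠ p.2 ∧ r p.1 u ∧ r p.2 v} ≤
    2 * Nat.card {p : V × V // p.1 ≠ p.2 ∧ r p.1 u ∧ r p.2 v ∧ H.Adj p.1 p.2}

/-- The disparity graph `D(H,c)`, for the colouring encoded by the relation `r`. -/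
def disparity {V : Type*} (H : SimpleGraph V) (r : V → V → Prop) : SimpleGraph V :=
  SimpleGraph.fromRel fun u v => Xor' (H.Adj u v) (majority H r u v)

/-- The generalised disparity graph `D_L(H,c)` for a 0-1 matrix `L` on colours. -/
def gDisparity {V : Type*} {Ω : Type*} (H : SimpleGraph V) (c : V → Ω) (L : Ω → Ω → Bool) :
    SimpleGraph V :=
  SimpleGraph.fromRel fun u v => Xor' (H.Adj u v) (L (c u) (c v) = true)

/-- The vertex set of the connected component of `v` in `G`. -/
def compSet {V : Type*} (G : SimpleGraph V) (v : V) : Set V := {u | G.Reachable v u}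

/-- A colouring is equitable if any two vertices with the same colour have the same number of
neighbours in every colour class. -/
def IsEquitable {V : Type*} {Ω : Type*} (H : SimpleGraph V) (c : V → Ω) : Prop :=
  ∀ u v, c u = c v → ∀ a : Ω,
    Nat.card {x : V // H.Adj u x ∧ c x = a} = Nat.card {x : V // H.Adj v x ∧ c x = a}

/-- Vertex set of the `k`-core of `G`: the union of all vertex sets inducing minimum
degree at least `k`. -/
def kCore {V : Type*} (G : SimpleGraph V) (k : ℕ) : Set V :=
  ⋃₀ {S : Set V | ∀ v ∈ S, k ≤ Nat.card {u : V // u ∈ S ∧ G.Adj v u}}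

/-- `V_{2,3}(G)`: vertices of the 2-core of `G` having degree at least 3 in the 2-core. -/
def V23 {V : Type*} (G : SimpleGraph V) : Set V :=
  {v | v ∈ kCore G 2 ∧ 3 ≤ Nat.card {u : V // u ∈ kCore G 2 ∧ G.Adj v u}}

/-- The graph obtained from `G` by deleting all edges meeting `T`
(so that reachability in `avoidG G T` from `v ∉ T` is reachability in `G - T`). -/
def avoidG {V : Type*} (G : SimpleGraph V) (T : Set V) : SimpleGraph V :=
  SimpleGraph.fromRel fun u v => G.Adj u v ∧ u ∉ T ∧ v ∉ T

/-- `V_{2,3}^{safe}(G)`: vertices `v ∈ V_{2,3}(G)` such that after deleting any set of at most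
two other vertices, the component of `v` still contains at least 3 vertices of `V_{2,3}(G)`. -/
def V23safe {V : Type*} (G : SimpleGraph V) : Set V :=
  {v | v ∈ V23 G ∧ ∀ T : Finset V, T.card ≤ 2 → v ∉ T →
    3 ≤ Nat.card {w : V // w ∈ V23 G ∧ (avoidG G (T : Set V)).Reachable v w}}

open Classical in
/-- `Lmul G i u v w` is the multiplicity of the vertex `w` in the multiset `L^i_G(u,v)`. -/
noncomputable def Lmul {V : Type*} [Fintype V] (G : SimpleGraph V) : ℕ → V → V → V → ℕ
  | 0, u, _, w => if w = u then 1 else 0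
  | (i + 1), u, v, w =>
      (∑ x : V, if G.Adj w x then Lmul G i u v x else 0) -
        (∑ x : V, if G.Adj w x then Lmul G i v u x else 0)

/-- Union over `j < i` of the supports of `L^j_G(u,v)` and `L^j_G(v,u)`. -/
noncomputable def Sbelow {V : Type*} [Fintype V] (G : SimpleGraph V) (u v : V) (i : ℕ) :
    Set V :=
  {w | ∃ j < i, 0 < Lmul G j u v w ∨ 0 < Lmul G j v u w}

/-- `S^{≤ i}_G({u,v})`. -/
noncomputable def Sle {V : Type*} [Fintype V] (G : SimpleGraph V) (u v : V) (i : ℕ) : Set V :=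
  Sbelow G u v (i + 1)

/-- `S^{i}_G({u,v}) = S^{≤ i}_G({u,v}) \ S^{≤ i-1}_G({u,v})`. -/
noncomputable def Sat {V : Type*} [Fintype V] (G : SimpleGraph V) (u v : V) (i : ℕ) : Set V :=
  Sbelow G u v (i + 1) \ Sbelow G u v i

/-- Degree of a vertex (as `Nat.card` of the neighbour set, avoiding decidability issues). -/
noncomputable def ncDegree {V : Type*} (G : SimpleGraph V) (v : V) : ℕ :=
  Nat.card {u : V // G.Adj v u}

/-- The random refinement of a colouring `c`: each vertex `v` with `f v = true` receives
a brand-new colour unique to itself. -/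
def refineColor {V : Type*} {Ω : Type*} (c : V → Ω) (f : V → Bool) : V → Ω ⊕ V :=
  fun v => if f v then Sum.inr v else Sum.inl (c v)

/-- `D(H,c)` (for the colouring encoded by the relation `r`) is `s`-bounded: every
intersection of a colour class with a connected component of `D(H,c)` has at most
`s` elements. -/
def sBounded {V : Type*} (H : SimpleGraph V) (r : V → V → Prop) (s : ℕ) : Prop :=
  ∀ u v : V, Nat.card {w : V // r w u ∧ w ∈ compSet (disparity H r) v} ≤ s

/-- The type of canonical colours after `t` rounds of colour refinement. -/
def CCol : ℕ → Type
  | 0 => Unit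
  | (t + 1) => CCol t × Multiset (CCol t)

open Classical in
/-- The canonical colour of a vertex after `t` rounds of colour refinement. -/
noncomputable def canonColor {V : Type*} [Fintype V] (G : SimpleGraph V) :
    (t : ℕ) → V → CCol t
  | 0, _ => ()
  | (t + 1), v =>
      (canonColor G t v, (Finset.univ.filter fun w => G.Adj v w).val.map (canonColor G t))

/-- The modal probability `M(m,p)` of a `Binomial(m,p)` random variable. -/
noncomputable def modalProb (m : ℕ) (p : ℝ) : ℝ :=
  (m.choose ⌊(m + 1 : ℝ) * p⌋₊ : ℝ) * p ^ ⌊(m + 1 : ℝ) * p⌋₊ *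
    (1 - p) ^ (m - ⌊(m + 1 : ℝ) * p⌋₊)

namespace ColourRefinement

section Cube

variable {ι : Type*} [Fintype ι]

/-- The probability of the point `f` of the cube under the product Bernoulli distribution. -/
noncomputable def weight (p : ℝ) (f : ι → Bool) : ℝ := ∏ i, if f i then p else 1 - p

variable {p : ℝ}

theorem weight_nonneg (h0 : 0 ≤ p) (h1 : p ≤ 1) (f : ι → Bool) : 0 ≤ weight p f :=
  Finset.prod_nonneg fun i _ => by split_ifs <;> linarith

variable [DecidableEq ι]

/-- Expectation on the cube `ι → Bool` under the product Bernoulli distribution. -/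
noncomputable def expect (p : ℝ) (X : (ι → Bool) → ℝ) : ℝ := ∑ f, weight p f * X f

open Classical in
/-- Probability on the cube `ι → Bool` under the product Bernoulli distribution. -/
noncomputable def prob (p : ℝ) (E : (ι → Bool) → Prop) : ℝ :=
  expect p fun f => if E f then 1 else 0

theorem expect_mono (h0 : 0 ≤ p) (h1 : p ≤ 1) {X Y : (ι → Bool) → ℝ} (h : ∀ f, X f ≤ Y f) :
    expect p X ≤ expect p Y :=
  Finset.sum_le_sum fun f _ => mul_le_mul_of_nonneg_left (h f) (weight_nonneg h0 h1 f)

theorem expect_nonneg (h0 : 0 ≤ p) (h1 : p ≤ 1) {X : (ι → Bool) → ℝ} (h : ∀ f, 0 ≤ X f) :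
    0 ≤ expect p X :=
  Finset.sum_nonneg fun f _ => mul_nonneg (weight_nonneg h0 h1 f) (h f)

theorem expect_const_mul (c : ℝ) (X : (ι → Bool) → ℝ) :
    expect p (fun f => c * X f) = c * expect p X := by
  simp only [expect, Finset.mul_sum]
  exact Finset.sum_congr rfl fun f _ => by ring

theorem expect_add (X Y : (ι → Bool) → ℝ) :
    expect p (fun f => X f + Y f) = expect p X + expect p Y := by
  simp only [expect, mul_add, Finset.sum_add_distrib]

theorem expect_sum {J : Type*} (I : Finset J) (X : J → (ι → Bool) → ℝ) :
    expect p (fun f => ∑ j ∈ I, X j f) = ∑ j ∈ I, expect p (X j) := by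
  simp only [expect, Finset.mul_sum]
  exact Finset.sum_comm

theorem expect_prod (D : Finset ι) (φ : ι → Bool → ℝ) :
    expect p (fun f => ∏ i ∈ D, φ i (f i)) = ∏ i ∈ D, (p * φ i true + (1 - p) * φ i false) := by
  have h : ∀ f : ι → Bool, weight p f * ∏ i ∈ D, φ i (f i) =
      ∏ i, (if f i then p else 1 - p) * (if i ∈ D then φ i (f i) else 1) := by
    intro f
    rw [Finset.prod_mul_distrib, Fintype.prod_ite_mem]
    rfl
  simp only [expect, h]
  rw [← Fintype.piFinset_univ, ← Finset.prod_univ_sum (fun _ : ι => (Finset.univ : Finset Bool))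
    (fun i b => (if b then p else 1 - p) * (if i ∈ D then φ i b else 1))]
  refine Eq.trans (Finset.prod_congr rfl fun i _ => ?_) (Fintype.prod_ite_mem D _)
  by_cases hi : i ∈ D <;> simp [hi]

theorem expect_const (c : ℝ) : expect p (fun _ : ι → Bool => c) = c := by
  have h := expect_prod (p := p) (∅ : Finset ι) fun _ _ => 1
  have h2 := expect_const_mul (p := p) c fun _ : ι → Bool => (1 : ℝ)
  simp only [Finset.prod_empty] at h
  rw [h] at h2
  simpa using h2

theorem expect_resample (D : Finset ι) (X : (ι → Bool) → ℝ) :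
    expect p (fun f => expect p fun g => X (D.piecewise g f)) = expect p X := by
  have hinv : Function.Involutive fun x : (ι → Bool) × (ι → Bool) =>
      (D.piecewise x.2 x.1, D.piecewise x.1 x.2) := by
    intro x
    ext i <;> by_cases hi : i ∈ D <;> simp [hi]
  have hw : ∀ f g : ι → Bool, weight p (D.piecewise g f) * weight p (D.piecewise f g) =
      weight p f * weight p g := by
    intro f g
    simp only [weight, ← Finset.prod_mul_distrib]
    refine Finset.prod_congr rfl fun i _ => ?_
    by_cases hi : i ∈ D <;> simp [hi, mul_comm]
  have h1 : expect p (fun f => expect p fun g => X (D.piecewise g f)) =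
      ∑ x : (ι → Bool) × (ι → Bool), weight p x.1 * weight p x.2 * X (D.piecewise x.2 x.1) := by
    simp only [expect, Finset.mul_sum, Fintype.sum_prod_type, mul_assoc]
  have h2 : expect p X =
      ∑ x : (ι → Bool) × (ι → Bool), weight p x.1 * weight p x.2 * X x.1 := by
    rw [Fintype.sum_prod_type]
    refine Finset.sum_congr rfl fun f _ => ?_
    have := expect_const (ι := ι) (p := p) (weight p f * X f)
    rw [← this, expect]
    exact Finset.sum_congr rfl fun g _ => by ring
  rw [h1, h2, ← Equiv.sum_comp (Function.Involutive.toPerm _ hinv)]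
  refine Finset.sum_congr rfl fun x _ => ?_
  have : Function.Involutive.toPerm _ hinv x = (D.piecewise x.2 x.1, D.piecewise x.1 x.2) := rfl
  rw [this]
  simp only [hw]
  congr 2
  ext i
  by_cases hi : i ∈ D <;> simp [hi]

theorem expect_update (i : ι) (X : (ι → Bool) → ℝ) :
    expect p X = p * expect p (fun f => X (Function.update f i true)) +
      (1 - p) * expect p (fun f => X (Function.update f i false)) := by
  rw [← expect_resample {i} X, ← expect_const_mul, ← expect_const_mul, ← expect_add]
  congr 1
  funext f
  have h := expect_prod (p := p) {i} fun _ b => X (Function.update f i b)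
  simpa [Finset.piecewise_singleton] using h

/-- A product of functions, each having small conditional expectation given the coordinates
outside a block of its own which the other functions ignore, has small expectation. -/
theorem expect_prod_le {J : Type*} [DecidableEq J] (h0 : 0 ≤ p) (h1 : p ≤ 1) (I : Finset J)
    (D : J → Finset ι) (h : J → (ι → Bool) → ℝ) (C : J → ℝ)
    (hpos : ∀ j ∈ I, ∀ f, 0 ≤ h j f) (hC : ∀ j ∈ I, 0 ≤ C j)
    (hinv : ∀ i ∈ I, ∀ j ∈ I, i ≠ j → ∀ f g, h i ((D j).piecewise g f) = h i f)
    (hb : ∀ j ∈ I, ∀ f, expect p (fun g => h j ((D j).piecewise g f)) ≤ C j) :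
    expect p (fun f => ∏ j ∈ I, h j f) ≤ ∏ j ∈ I, C j := by
  induction I using Finset.induction_on with
  | empty => simp [expect_const]
  | insert j I hj ih =>
    have ih' := ih (fun i hi => hpos i (Finset.mem_insert_of_mem hi))
      (fun i hi => hC i (Finset.mem_insert_of_mem hi))
      (fun i hi k hk => hinv i (Finset.mem_insert_of_mem hi) k (Finset.mem_insert_of_mem hk))
      (fun i hi => hb i (Finset.mem_insert_of_mem hi))
    have hjm : j ∈ insert j I := Finset.mem_insert_self _ _
    rw [Finset.prod_insert hj, ← expect_resample (D j)]
    calc expect p (fun f => expect p fun g => ∏ i ∈ insert j I, h i ((D j).piecewise g f))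
        ≤ expect p (fun f => C j * ∏ i ∈ I, h i f) := by
          refine expect_mono h0 h1 fun f => ?_
          have : (fun g => ∏ i ∈ insert j I, h i ((D j).piecewise g f)) =
              fun g => (∏ i ∈ I, h i f) * h j ((D j).piecewise g f) := by
            funext g
            rw [Finset.prod_insert hj, mul_comm]
            congr 1
            refine Finset.prod_congr rfl fun i hi => ?_
            exact hinv i (Finset.mem_insert_of_mem hi) j hjm (fun e => hj (e ▸ hi)) f g
          rw [this, expect_const_mul, mul_comm]
          exact mul_le_mul_of_nonneg_right (hb j hjm f)
            (Finset.prod_nonneg fun i hi => hpos i (Finset.mem_insert_of_mem hi) f)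
      _ = C j * expect p (fun f => ∏ i ∈ I, h i f) := expect_const_mul _ _
      _ ≤ _ := mul_le_mul_of_nonneg_left ih' (hC j hjm)

theorem prob_mono (h0 : 0 ≤ p) (h1 : p ≤ 1) {E F : (ι → Bool) → Prop} (h : ∀ f, E f → F f) :
    prob p E ≤ prob p F := by
  refine expect_mono h0 h1 fun f => ?_
  by_cases hE : E f
  · simp [hE, h f hE]
  · simp only [hE, if_false]
    split_ifs <;> norm_num

theorem prob_nonneg (h0 : 0 ≤ p) (h1 : p ≤ 1) (E : (ι → Bool) → Prop) : 0 ≤ prob p E :=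
  expect_nonneg h0 h1 fun f => by split_ifs <;> norm_num

theorem prob_or_le (h0 : 0 ≤ p) (h1 : p ≤ 1) (E F : (ι → Bool) → Prop) :
    prob p (fun f => E f ∨ F f) ≤ prob p E + prob p F := by
  rw [prob, prob, prob, ← expect_add]
  refine expect_mono h0 h1 fun f => ?_
  by_cases hE : E f <;> by_cases hF : F f <;> simp [hE, hF]

theorem prob_not (E : (ι → Bool) → Prop) : prob p (fun f => ¬ E f) = 1 - prob p E := by
  have h : prob p E + prob p (fun f => ¬ E f) = 1 := by
    rw [prob, prob, ← expect_add]
    refine Eq.trans ?_ (expect_const (ι := ι) (p := p) 1)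
    congr 1
    funext f
    by_cases hE : E f <;> simp [hE]
  linarith

theorem prob_exists_le {J : Type*} (h0 : 0 ≤ p) (h1 : p ≤ 1) (I : Finset J)
    (E : J → (ι → Bool) → Prop) :
    prob p (fun f => ∃ j ∈ I, E j f) ≤ ∑ j ∈ I, prob p (E j) := by
  simp only [prob]
  rw [← expect_sum]
  refine expect_mono h0 h1 fun f => ?_
  have hn : ∀ j ∈ I, (0 : ℝ) ≤ (open Classical in if E j f then 1 else 0) := fun j _ => by
    split_ifs <;> norm_num
  split_ifs with h
  · obtain ⟨j, hj, hE⟩ := h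
    refine le_trans ?_ (Finset.single_le_sum hn hj)
    simp [hE]
  · exact Finset.sum_nonneg hn

/-- Markov's inequality. -/
theorem mul_prob_le_expect (h0 : 0 ≤ p) (h1 : p ≤ 1) {E : (ι → Bool) → Prop}
    {X : (ι → Bool) → ℝ} (hX : ∀ f, 0 ≤ X f) (c : ℝ) (h : ∀ f, E f → c ≤ X f) :
    c * prob p E ≤ expect p X := by
  rw [prob, ← expect_const_mul]
  refine expect_mono h0 h1 fun f => ?_
  split_ifs with hE
  · simpa using h f hE
  · simpa using hX f

/-- Two independent rounds of flips amount to one round of flips. -/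
theorem expect_xor (q r : ℝ) (X : (ι → Bool) → ℝ) :
    expect q (fun g => expect r fun f => X fun i => xor (g i) (f i)) =
      expect (q * (1 - r) + r * (1 - q)) X := by
  have h : ∀ g : ι → Bool, expect r (fun f => X fun i => xor (g i) (f i)) =
      ∑ f, weight r (fun i => xor (g i) (f i)) * X f := by
    intro g
    have hinv : Function.Involutive fun (f : ι → Bool) (i : ι) => xor (g i) (f i) := by
      intro f
      funext i
      simp
    rw [expect, ← Equiv.sum_comp (Function.Involutive.toPerm _ hinv)]
    refine Finset.sum_congr rfl fun f _ => ?_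
    have : Function.Involutive.toPerm _ hinv f = fun i => xor (g i) (f i) := rfl
    rw [this]
    simp
  simp only [h]
  simp only [expect, Finset.mul_sum]
  rw [Finset.sum_comm]
  refine Finset.sum_congr rfl fun f _ => ?_
  simp only [← mul_assoc, ← Finset.sum_mul]
  congr 1
  simp only [weight, ← Finset.prod_mul_distrib]
  rw [← Fintype.piFinset_univ, ← Finset.prod_univ_sum (fun _ : ι => (Finset.univ : Finset Bool))
    (fun i b => (if b then q else 1 - q) * (if xor b (f i) then r else 1 - r))]
  refine Finset.prod_congr rfl fun i _ => ?_
  cases f i <;> simp <;> ring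

end Cube

section SignedSum

variable {ι : Type*}

/-- The sum of the signs `s i` over the flipped coordinates `i ∈ D`. -/
def signedSum (s : ι → ℤ) (D : Finset ι) (f : ι → Bool) : ℤ := ∑ i ∈ D, if f i then s i else 0

/-- The weight `K` raised to the number of flipped coordinates in `D`. -/
noncomputable def tilt (K : ℝ) (D : Finset ι) (f : ι → Bool) : ℝ := ∏ i ∈ D, if f i then K else 1

theorem tilt_nonneg {K : ℝ} (hK : 0 ≤ K) (D : Finset ι) (f : ι → Bool) : 0 ≤ tilt K D f :=
  Finset.prod_nonneg fun i _ => by split_ifs <;> linarith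

variable [DecidableEq ι]

theorem signedSum_insert_update_true (s : ι → ℤ) {D : Finset ι} {i : ι} (hi : i ∉ D)
    (f : ι → Bool) :
    signedSum s (insert i D) (Function.update f i true) = s i + signedSum s D f := by
  rw [signedSum, Finset.sum_insert hi, signedSum]
  congr 1
  · simp
  · refine Finset.sum_congr rfl fun j hj => ?_
    rw [Function.update_of_ne (ne_of_mem_of_not_mem hj hi)]

theorem signedSum_insert_update_false (s : ι → ℤ) {D : Finset ι} {i : ι} (hi : i ∉ D)
    (f : ι → Bool) :
    signedSum s (insert i D) (Function.update f i false) = signedSum s D f := by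
  rw [signedSum, Finset.sum_insert hi, signedSum]
  simp only [Function.update_self, Bool.false_eq_true, if_false, zero_add]
  refine Finset.sum_congr rfl fun j hj => ?_
  rw [Function.update_of_ne (ne_of_mem_of_not_mem hj hi)]

theorem tilt_insert_update (K : ℝ) {D : Finset ι} {i : ι} (hi : i ∉ D) (f : ι → Bool) (b : Bool) :
    tilt K (insert i D) (Function.update f i b) = (if b then K else 1) * tilt K D f := by
  rw [tilt, Finset.prod_insert hi, tilt]
  congr 1
  · simp
  · refine Finset.prod_congr rfl fun j hj => ?_
    rw [Function.update_of_ne (ne_of_mem_of_not_mem hj hi)]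

variable [Fintype ι] {p : ℝ}

/-- The tilted probability that the signed sum over `D` equals `d`. -/
noncomputable def tiltedProb (p K : ℝ) (s : ι → ℤ) (D : Finset ι) (d : ℤ) : ℝ :=
  expect p fun f => tilt K D f * if signedSum s D f = d then 1 else 0

theorem tiltedProb_insert (p K : ℝ) (s : ι → ℤ) {D : Finset ι} {i : ι} (hi : i ∉ D) (d : ℤ) :
    tiltedProb p K s (insert i D) d =
      p * (K * tiltedProb p K s D (d - s i)) + (1 - p) * tiltedProb p K s D d := by
  rw [tiltedProb, expect_update i, tiltedProb, tiltedProb, ← expect_const_mul K]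
  simp only [signedSum_insert_update_true s hi, signedSum_insert_update_false s hi,
    tilt_insert_update K hi, eq_sub_iff_add_eq', if_true, Bool.false_eq_true, if_false, one_mul,
    mul_assoc]

theorem tiltedProb_le_one_and {K : ℝ} (h0 : 0 ≤ p) (h1 : p ≤ 1) (hK : 1 ≤ K) (s : ι → ℤ)
    (hs : ∀ i, s i ≠ 0) (D : Finset ι) (hD : K ^ 2 * p * D.card ≤ 1) (d : ℤ) :
    tiltedProb p K s D d ≤ 1 ∧ (d ≠ 0 → tiltedProb p K s D d ≤ K * p * D.card) := by
  induction D using Finset.induction_on generalizing d with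
  | empty =>
    simp only [tiltedProb, tilt, signedSum, Finset.prod_empty, Finset.sum_empty, one_mul,
      Finset.card_empty]
    constructor
    · by_cases hd : 0 = d <;> simp [hd, expect_const]
    · intro hd
      simp [Ne.symm hd, expect_const]
  | insert i D hi ih =>
    rw [Finset.card_insert_of_notMem hi, Nat.cast_succ] at hD ⊢
    have hKp : 0 ≤ K ^ 2 * p := by positivity
    have hD' : K ^ 2 * p * D.card ≤ 1 := by nlinarith
    have hKD : K * p * D.card ≤ 1 := by
      have : (0 : ℝ) ≤ K * p * D.card := by positivity
      nlinarith
    have hpK : 0 ≤ p * K := by positivity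
    rw [tiltedProb_insert p K s hi]
    have hne : d ≠ 0 → p * (K * tiltedProb p K s D (d - s i)) +
        (1 - p) * tiltedProb p K s D d ≤ K * p * (D.card + 1) := by
      intro hd
      have e1 := mul_le_mul_of_nonneg_left (ih hD' (d - s i)).1 hpK
      have e2 := mul_le_mul_of_nonneg_left ((ih hD' d).2 hd) (sub_nonneg.2 h1)
      have : 0 ≤ p * (K * p * D.card) := by positivity
      nlinarith
    refine ⟨?_, hne⟩
    by_cases hd : d = 0
    · have e1 := mul_le_mul_of_nonneg_left
        ((ih hD' (d - s i)).2 (by rw [hd, zero_sub]; exact neg_ne_zero.2 (hs i))) hpK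
      have e2 := mul_le_mul_of_nonneg_left (ih hD' d).1 (sub_nonneg.2 h1)
      nlinarith
    · refine (hne hd).trans ?_
      have : (0 : ℝ) ≤ K * p * (D.card + 1) := by positivity
      nlinarith

theorem tiltedProb_one_le_parity (h0 : 0 ≤ p) (h1 : p ≤ 1 / 2) (s : ι → ℤ)
    (hs : ∀ i, s i = 1 ∨ s i = -1) (D : Finset ι) (d : ℤ) :
    tiltedProb p 1 s D d ≤ 1 / 2 + Real.exp (-(2 * (p * D.card))) / 2 := by
  have hprod : ∀ f : ι → Bool, (-1 : ℝ) ^ signedSum s D f = tilt (-1) D f := by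
    intro f
    induction D using Finset.induction_on with
    | empty => simp [signedSum, tilt]
    | insert i D hi ih =>
      rw [signedSum, Finset.sum_insert hi, tilt, Finset.prod_insert hi,
        zpow_add₀ (by norm_num), ← tilt, ← ih]
      congr 1
      rcases hs i with h | h <;> cases f i <;> simp [h]
  have hE : expect p (tilt (-1) D) = (1 - 2 * p) ^ D.card := by
    have h := expect_prod (p := p) D fun _ b => if b then -1 else 1
    simp only [if_true, Bool.false_eq_true, if_false, Finset.prod_const] at h
    refine h.trans ?_
    congr 1
    ring
  have hσ : ((-1 : ℝ) ^ d) * (-1) ^ d = 1 := by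
    rw [← mul_zpow]
    simp
  have hσ1 : ((-1 : ℝ) ^ d) ≤ 1 := by nlinarith
  calc tiltedProb p 1 s D d
      ≤ expect p (fun f => 1 / 2 + ((-1 : ℝ) ^ d / 2) * tilt (-1) D f) := by
        refine expect_mono h0 (by linarith) fun f => ?_
        have ht : tilt 1 D f = 1 := by simp [tilt]
        rw [ht, one_mul, ← hprod]
        split_ifs with h
        · rw [h]
          nlinarith
        · have h2 : ((-1 : ℝ) ^ signedSum s D f) * (-1) ^ signedSum s D f = 1 := by
            rw [← mul_zpow]
            simp
          nlinarith [sq_nonneg ((-1 : ℝ) ^ d + (-1 : ℝ) ^ signedSum s D f)]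
    _ = 1 / 2 + ((-1 : ℝ) ^ d / 2) * (1 - 2 * p) ^ D.card := by
        rw [expect_add, expect_const, expect_const_mul, hE]
    _ ≤ 1 / 2 + Real.exp (-(2 * (p * D.card))) / 2 := by
        have h3 : (1 - 2 * p) ^ D.card ≤ Real.exp (-(2 * (p * D.card))) := by
          calc (1 - 2 * p) ^ D.card ≤ Real.exp (-(2 * p)) ^ D.card := by
                gcongr
                · linarith
                · linarith [Real.add_one_le_exp (-(2 * p))]
            _ = _ := by
                rw [← Real.exp_nat_mul]
                congr 1
                ring
        have h4 : 0 ≤ (1 - 2 * p) ^ D.card := pow_nonneg (by linarith) _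
        nlinarith

theorem expect_cos_sq_add_expect_sin_sq_le (h0 : 0 ≤ p) (h1 : p ≤ 1 / 2) (s : ι → ℤ)
    (hs : ∀ i, s i = 1 ∨ s i = -1) (D : Finset ι) (α : ℝ) :
    expect p (fun f => Real.cos (α * signedSum s D f)) ^ 2 +
      expect p (fun f => Real.sin (α * signedSum s D f)) ^ 2 ≤
        Real.exp (-(p * D.card * (1 - Real.cos α))) := by
  induction D using Finset.induction_on with
  | empty => simp [signedSum, expect_const]
  | insert i D hi ih =>
    set C := expect p (fun f => Real.cos (α * signedSum s D f))
    set S := expect p (fun f => Real.sin (α * signedSum s D f))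
    obtain ⟨β, hβ, hcos⟩ : ∃ β : ℝ, α * s i = β ∧ Real.cos β = Real.cos α := by
      rcases hs i with h | h
      · exact ⟨α, by rw [h]; simp, rfl⟩
      · exact ⟨-α, by rw [h]; simp, Real.cos_neg α⟩
    have eC : expect p (fun f => Real.cos (α * signedSum s (insert i D) f)) =
        p * (Real.cos β * C + -Real.sin β * S) + (1 - p) * C := by
      rw [expect_update i]
      simp only [signedSum_insert_update_true s hi, signedSum_insert_update_false s hi,
        Int.cast_add, mul_add, hβ, Real.cos_add]
      rw [← expect_const_mul (Real.cos β), ← expect_const_mul (-Real.sin β)]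
      rw [← mul_add, ← expect_add]
      simp only [neg_mul, ← sub_eq_add_neg]
      rfl
    have eS : expect p (fun f => Real.sin (α * signedSum s (insert i D) f)) =
        p * (Real.sin β * C + Real.cos β * S) + (1 - p) * S := by
      rw [expect_update i]
      simp only [signedSum_insert_update_true s hi, signedSum_insert_update_false s hi,
        Int.cast_add, mul_add, hβ, Real.sin_add]
      rw [← expect_const_mul (Real.sin β), ← expect_const_mul (Real.cos β)]
      rw [← mul_add, ← expect_add]
    rw [eC, eS]
    have hsc := Real.sin_sq_add_cos_sq β
    have key : (p * (Real.cos β * C + -Real.sin β * S) + (1 - p) * C) ^ 2 +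
        (p * (Real.sin β * C + Real.cos β * S) + (1 - p) * S) ^ 2 =
        (C ^ 2 + S ^ 2) * (1 - 2 * p * (1 - p) * (1 - Real.cos α)) := by
      rw [← hcos]
      linear_combination (p ^ 2 * C ^ 2 + p ^ 2 * S ^ 2) * hsc
    rw [key, Finset.card_insert_of_notMem hi, Nat.cast_succ]
    have hx : 0 ≤ 1 - Real.cos α := by linarith [Real.cos_le_one α]
    have hfac : 1 - 2 * p * (1 - p) * (1 - Real.cos α) ≤
        Real.exp (-(p * (1 - Real.cos α))) := by
      have := Real.add_one_le_exp (-(p * (1 - Real.cos α)))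
      have h5 : 0 ≤ p * (1 - 2 * p) * (1 - Real.cos α) :=
        mul_nonneg (mul_nonneg h0 (by linarith)) hx
      nlinarith
    calc (C ^ 2 + S ^ 2) * (1 - 2 * p * (1 - p) * (1 - Real.cos α))
        ≤ (C ^ 2 + S ^ 2) * Real.exp (-(p * (1 - Real.cos α))) :=
          mul_le_mul_of_nonneg_left hfac (by positivity)
      _ ≤ Real.exp (-(p * D.card * (1 - Real.cos α))) * Real.exp (-(p * (1 - Real.cos α))) :=
          mul_le_mul_of_nonneg_right ih (Real.exp_pos _).le
      _ = _ := by
          rw [← Real.exp_add]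
          congr 1
          ring

theorem expect_cos_le (h0 : 0 ≤ p) (h1 : p ≤ 1 / 2) (s : ι → ℤ)
    (hs : ∀ i, s i = 1 ∨ s i = -1) (D : Finset ι) (α β : ℝ) :
    expect p (fun f => Real.cos (α * signedSum s D f - β)) ≤
      Real.exp (-(p * D.card * (1 - Real.cos α) / 2)) := by
  have h := expect_cos_sq_add_expect_sin_sq_le h0 h1 s hs D α
  set C := expect p (fun f => Real.cos (α * signedSum s D f)) with hC
  set S := expect p (fun f => Real.sin (α * signedSum s D f)) with hS
  have e : expect p (fun f => Real.cos (α * signedSum s D f - β)) =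
      Real.cos β * C + Real.sin β * S := by
    rw [hC, hS, ← expect_const_mul, ← expect_const_mul, ← expect_add]
    congr 1
    funext f
    rw [Real.cos_sub]
    ring
  rw [e]
  refine abs_le_of_sq_le_sq' ?_ (Real.exp_pos _).le |>.2
  have e2 : Real.exp (-(p * D.card * (1 - Real.cos α) / 2)) ^ 2 =
      Real.exp (-(p * D.card * (1 - Real.cos α))) := by
    rw [← Real.exp_nat_mul]
    congr 1
    push_cast
    ring
  rw [e2]
  refine le_trans ?_ h
  nlinarith [Real.sin_sq_add_cos_sq β, sq_nonneg (Real.cos β * S - Real.sin β * C)]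

theorem sum_cos_nonneg (N : ℕ) (x : ℝ) :
    0 ≤ ∑ k ∈ Finset.range N, ∑ l ∈ Finset.range N, Real.cos (((k : ℝ) - l) * x) := by
  have : ∑ k ∈ Finset.range N, ∑ l ∈ Finset.range N, Real.cos (((k : ℝ) - l) * x) =
      (∑ k ∈ Finset.range N, Real.cos (k * x)) ^ 2 +
        (∑ k ∈ Finset.range N, Real.sin (k * x)) ^ 2 := by
    simp only [sub_mul, Real.cos_sub, Finset.sum_add_distrib, sq, Finset.sum_mul_sum]
  rw [this]
  positivity

/-- Uniform anticoncentration of signed sums of many rare flips. -/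
theorem exists_tiltedProb_one_le {η : ℝ} (hη : 0 < η) : ∃ l : ℝ, 0 < l ∧
    ∀ {ι : Type} [Fintype ι] [DecidableEq ι] (p : ℝ) (_ : 0 ≤ p) (_ : p ≤ 1 / 2) (s : ι → ℤ)
      (_ : ∀ i, s i = 1 ∨ s i = -1) (D : Finset ι) (_ : l ≤ p * D.card) (d : ℤ),
      tiltedProb p 1 s D d ≤ η := by
  obtain ⟨N, hN⟩ := exists_nat_gt (2 / η)
  have hN0 : (0 : ℝ) < N := lt_trans (by positivity) hN
  set κ := 1 - Real.cos (1 / N) with hκ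
  have hinv : (1 : ℝ) / N ≤ 1 := by
    rw [div_le_one hN0]
    exact_mod_cast Nat.pos_of_ne_zero (fun h => by simp [h] at hN0)
  have hpi := Real.pi_gt_three
  have hκ0 : 0 < κ := by
    have := Real.cos_lt_cos_of_nonneg_of_le_pi le_rfl (by linarith)
      (show (0 : ℝ) < 1 / N by positivity)
    rw [Real.cos_zero] at this
    linarith
  obtain ⟨l, hl0, hl⟩ : ∃ l : ℝ, 0 < l ∧ Real.exp (-(l * κ / 2)) ≤ η / 2 := by
    refine ⟨2 * |Real.log (η / 2)| / κ + 1, by positivity, ?_⟩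
    rw [← Real.le_log_iff_exp_le (by positivity)]
    have := neg_abs_le (Real.log (η / 2))
    have e : (2 * |Real.log (η / 2)| / κ + 1) * κ / 2 = |Real.log (η / 2)| + κ / 2 := by
      field_simp
    rw [e]
    linarith
  refine ⟨l, hl0, fun {ι} _ _ p h0 h1 s hs D hD d => ?_⟩
  have hoff : ∀ k ∈ Finset.range N, ∀ j ∈ Finset.range N,
      expect p (fun f => Real.cos (((k : ℝ) - j) * (1 / N * signedSum s D f - 1 / N * d))) ≤
        (if k = j then 1 else 0) + η / 2 := by
    intro k hk j hj
    rw [Finset.mem_range] at hk hj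
    split_ifs with hkj
    · subst hkj
      simp only [sub_self, zero_mul, Real.cos_zero, expect_const]
      linarith
    · have hα : κ ≤ 1 - Real.cos (((k : ℝ) - j) * (1 / N)) := by
        have h1' : (1 : ℝ) ≤ |(k : ℝ) - j| := by
          have : (1 : ℤ) ≤ |(k : ℤ) - j| := Int.one_le_abs (by omega)
          exact_mod_cast this
        have h2' : |(k : ℝ) - j| ≤ N := by
          have : |(k : ℤ) - j| ≤ N := by rw [abs_le]; omega
          exact_mod_cast this
        have h3 : |((k : ℝ) - j) * (1 / N)| = |(k : ℝ) - j| / N := by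
          rw [abs_mul, abs_of_pos (show (0 : ℝ) < 1 / N by positivity)]
          ring
        have h4 : |(k : ℝ) - j| / N ≤ 1 := by
          rw [div_le_one hN0]
          exact h2'
        rw [← Real.cos_abs (((k : ℝ) - j) * (1 / N)), h3]
        have := Real.cos_le_cos_of_nonneg_of_le_pi (show (0 : ℝ) ≤ 1 / N by positivity)
          (show |(k : ℝ) - j| / N ≤ Real.pi by linarith) (by gcongr)
        linarith
      have h5 := expect_cos_le h0 h1 s hs D (((k : ℝ) - j) * (1 / N)) (((k : ℝ) - j) * (1 / N) * d)
      rw [zero_add]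
      have h6 : l * κ ≤ p * D.card * (1 - Real.cos (((k : ℝ) - j) * (1 / N))) :=
        mul_le_mul hD hα hκ0.le (hl0.le.trans hD)
      calc expect p (fun f => Real.cos (((k : ℝ) - j) * (1 / N * signedSum s D f - 1 / N * d)))
          = expect p (fun f => Real.cos (((k : ℝ) - j) * (1 / N) * signedSum s D f -
              ((k : ℝ) - j) * (1 / N) * d)) := by
            congr 1
            funext f
            congr 1
            ring
        _ ≤ _ := h5
        _ ≤ Real.exp (-(l * κ / 2)) := Real.exp_le_exp.2 (by linarith)
        _ ≤ η / 2 := hl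
  have hmain : (N : ℝ) ^ 2 * tiltedProb p 1 s D d ≤ N + N ^ 2 * (η / 2) := by
    calc (N : ℝ) ^ 2 * tiltedProb p 1 s D d
        ≤ expect p (fun f => ∑ k ∈ Finset.range N, ∑ j ∈ Finset.range N,
            Real.cos (((k : ℝ) - j) * (1 / N * signedSum s D f - 1 / N * d))) := by
          rw [tiltedProb, ← expect_const_mul]
          refine expect_mono h0 (by linarith) fun f => ?_
          have ht : tilt 1 D f = 1 := by simp [tilt]
          rw [ht, one_mul]
          split_ifs with h
          · rw [h]
            simp [sq]
          · simpa using sum_cos_nonneg N (1 / N * signedSum s D f - 1 / N * d)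
      _ = ∑ k ∈ Finset.range N, ∑ j ∈ Finset.range N, expect p (fun f =>
            Real.cos (((k : ℝ) - j) * (1 / N * signedSum s D f - 1 / N * d))) := by
          rw [expect_sum]
          exact Finset.sum_congr rfl fun k _ => expect_sum _ _
      _ ≤ ∑ k ∈ Finset.range N, ∑ j ∈ Finset.range N, ((if k = j then 1 else 0) + η / 2) :=
          Finset.sum_le_sum fun k hk => Finset.sum_le_sum fun j hj => hoff k hk j hj
      _ = N + N ^ 2 * (η / 2) := by
          have : ∀ k ∈ Finset.range N, ∑ j ∈ Finset.range N, ((if k = j then (1 : ℝ) else 0) + η / 2)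
              = 1 + N * (η / 2) := by
            intro k hk
            rw [Finset.sum_add_distrib, Finset.sum_ite_eq, if_pos hk]
            simp
          rw [Finset.sum_congr rfl this]
          simp only [Finset.sum_const, Finset.card_range, nsmul_eq_mul]
          ring
  have hNη : (N : ℝ) ≤ N ^ 2 * (η / 2) := by
    rw [div_lt_iff₀ hη] at hN
    nlinarith
  have h7 : (N : ℝ) ^ 2 * tiltedProb p 1 s D d ≤ N ^ 2 * η := by linarith
  exact le_of_mul_le_mul_left h7 (by positivity)

end SignedSum

section Blocks

variable {V : Type*}

/-- The edge indicator `a` with the edges marked by `f` flipped. -/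
def flipBy (a f : Sym2 V → Bool) : Sym2 V → Bool := fun e => xor (a e) (f e)

/-- The change of the indicator `a` caused by flipping an edge. -/
def flipSign (a : Sym2 V → Bool) : Sym2 V → ℤ := fun e => if a e then -1 else 1

theorem flipSign_eq (a : Sym2 V → Bool) (e : Sym2 V) : flipSign a e = 1 ∨ flipSign a e = -1 := by
  cases h : a e <;> simp [flipSign, h]

/-- The number of `w ∈ B` with `y s(u, w)`. -/
def nbrCount (y : Sym2 V → Bool) (B : Finset V) (u : V) : ℕ := (B.filter fun w => y s(u, w)).card

theorem nbrCount_congr {y z : Sym2 V → Bool} {B : Finset V} {u : V}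
    (h : ∀ w ∈ B, y s(u, w) = z s(u, w)) : nbrCount y B u = nbrCount z B u := by
  rw [nbrCount, nbrCount]
  congr 1
  refine Finset.filter_congr fun w hw => ?_
  rw [h w hw]

variable [DecidableEq V]

/-- The star of pairs joining `u` to `B`. -/
def starAt (u : V) (B : Finset V) : Finset (Sym2 V) := B.image fun w => s(u, w)

theorem sum_star {M : Type*} [AddCommMonoid M] (u : V) (B : Finset V) (φ : Sym2 V → M) :
    ∑ e ∈ starAt u B, φ e = ∑ w ∈ B, φ s(u, w) :=
  Finset.sum_image fun _ _ _ _ h => Sym2.congr_right.1 h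

theorem prod_star {M : Type*} [CommMonoid M] (u : V) (B : Finset V) (φ : Sym2 V → M) :
    ∏ e ∈ starAt u B, φ e = ∏ w ∈ B, φ s(u, w) :=
  Finset.prod_image fun _ _ _ _ h => Sym2.congr_right.1 h

theorem card_star (u : V) (B : Finset V) : (starAt u B).card = B.card :=
  Finset.card_image_of_injective _ fun _ _ h => Sym2.congr_right.1 h

theorem nbrCount_flip (a f : Sym2 V → Bool) (B : Finset V) (u : V) :
    (nbrCount (flipBy a f) B u : ℤ) = nbrCount a B u + signedSum (flipSign a) (starAt u B) f := by
  rw [nbrCount, nbrCount, signedSum, sum_star, Finset.card_filter, Finset.card_filter]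
  push_cast
  rw [← Finset.sum_add_distrib]
  refine Finset.sum_congr rfl fun w _ => ?_
  cases h : a s(u, w) <;> cases h' : f s(u, w) <;> simp [flipBy, flipSign, h, h']

variable [Fintype V] {p : ℝ}

theorem expect_prod_tilt_le (h0 : 0 ≤ p) (h1 : p ≤ 1) (a : Sym2 V → Bool) (N J : Finset V)
    (ρ : V → V) (B : V → Finset V) (hρ : ∀ u ∈ N, ρ u ∉ N)
    (hB : ∀ s ∈ J, ∀ t ∈ J, s ≠ t → Disjoint (B s) (B t)) (hBN : ∀ s ∈ J, Disjoint (B s) N)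
    {K C : ℝ} (hK : 0 ≤ K) (hC : 0 ≤ C)
    (hb : ∀ u ∈ N, ∀ s ∈ J, ∀ d, tiltedProb p K (flipSign a) (starAt u (B s)) d ≤ C) :
    expect p (fun f => ∏ j ∈ N ×ˢ J, (tilt K (starAt j.1 (B j.2)) f *
      if nbrCount (flipBy a f) (B j.2) j.1 = nbrCount (flipBy a f) (B j.2) (ρ j.1) then 1 else 0)) ≤
      C ^ (N.card * J.card) := by
  have hN : ∀ i ∈ N ×ˢ J, ∀ j ∈ N ×ˢ J, i ≠ j → ∀ w ∈ B i.2, s(i.1, w) ∉ starAt j.1 (B j.2) := by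
    rintro ⟨u, s⟩ hi ⟨v, t⟩ hj hij w hw hmem
    rw [Finset.mem_product] at hi hj
    obtain ⟨w', hw', e⟩ := Finset.mem_image.1 hmem
    rcases Sym2.eq_iff.1 e with ⟨e1, e2⟩ | ⟨e1, e2⟩
    · refine hij (Prod.ext e1.symm ?_)
      by_contra hst
      exact Finset.disjoint_left.1 (hB s hi.2 t hj.2 hst) hw (e2 ▸ hw')
    · exact Finset.disjoint_left.1 (hBN t hj.2) hw' (e2 ▸ hi.1)
  have hR : ∀ i ∈ N ×ˢ J, ∀ j ∈ N ×ˢ J, ∀ w ∈ B i.2, s(ρ i.1, w) ∉ starAt j.1 (B j.2) := by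
    rintro ⟨u, s⟩ hi ⟨v, t⟩ hj w hw hmem
    rw [Finset.mem_product] at hi hj
    obtain ⟨w', hw', e⟩ := Finset.mem_image.1 hmem
    rcases Sym2.eq_iff.1 e with ⟨e1, e2⟩ | ⟨e1, e2⟩
    · exact hρ u hi.1 (e1 ▸ hj.1)
    · exact Finset.disjoint_left.1 (hBN s hi.2) hw (e1 ▸ hj.1)
  have hRc : ∀ i ∈ N ×ˢ J, ∀ j ∈ N ×ˢ J, ∀ f g,
      nbrCount (flipBy a ((starAt j.1 (B j.2)).piecewise g f)) (B i.2) (ρ i.1) =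
        nbrCount (flipBy a f) (B i.2) (ρ i.1) := by
    intro i hi j hj f g
    refine nbrCount_congr fun w hw => ?_
    rw [flipBy, flipBy, Finset.piecewise_eq_of_notMem _ _ _ (hR i hi j hj w hw)]
  rw [← Finset.card_product, ← Finset.prod_const]
  refine expect_prod_le h0 h1 _ (fun j => starAt j.1 (B j.2)) _ _ ?_ (fun _ _ => hC) ?_ ?_
  · intro j _ f
    have := tilt_nonneg hK (starAt j.1 (B j.2)) f
    split_ifs <;> simp [this]
  · intro i hi j hj hij f g
    have e1 : tilt K (starAt i.1 (B i.2)) ((starAt j.1 (B j.2)).piecewise g f) =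
        tilt K (starAt i.1 (B i.2)) f := by
      rw [tilt, tilt, prod_star, prod_star]
      refine Finset.prod_congr rfl fun w hw => ?_
      rw [Finset.piecewise_eq_of_notMem _ _ _ (hN i hi j hj hij w hw)]
    have e2 : nbrCount (flipBy a ((starAt j.1 (B j.2)).piecewise g f)) (B i.2) i.1 =
        nbrCount (flipBy a f) (B i.2) i.1 := by
      refine nbrCount_congr fun w hw => ?_
      rw [flipBy, flipBy, Finset.piecewise_eq_of_notMem _ _ _ (hN i hi j hj hij w hw)]
    simp only [e1, e2, hRc i hi j hj]
  · intro j hj f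
    have hj' := Finset.mem_product.1 hj
    refine le_trans (le_of_eq ?_) (hb j.1 hj'.1 j.2 hj'.2
      (nbrCount (flipBy a f) (B j.2) (ρ j.1) - nbrCount a (B j.2) j.1))
    rw [tiltedProb]
    congr 1
    funext g
    have e0 : ∀ e ∈ starAt j.1 (B j.2), (starAt j.1 (B j.2)).piecewise g f e = g e := fun e he =>
      Finset.piecewise_eq_of_mem _ _ _ he
    have e1 : tilt K (starAt j.1 (B j.2)) ((starAt j.1 (B j.2)).piecewise g f) =
        tilt K (starAt j.1 (B j.2)) g :=
      Finset.prod_congr rfl fun e he => by rw [e0 e he]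
    have e2 : signedSum (flipSign a) (starAt j.1 (B j.2)) ((starAt j.1 (B j.2)).piecewise g f) =
        signedSum (flipSign a) (starAt j.1 (B j.2)) g :=
      Finset.sum_congr rfl fun e he => by rw [e0 e he]
    have e3 : ∀ z : ℕ, nbrCount (flipBy a ((starAt j.1 (B j.2)).piecewise g f)) (B j.2) j.1 = z ↔
        signedSum (flipSign a) (starAt j.1 (B j.2)) g = z - nbrCount a (B j.2) j.1 := by
      intro z
      have := nbrCount_flip a ((starAt j.1 (B j.2)).piecewise g f) (B j.2) j.1
      rw [e2] at this
      omega
    rw [e1, hRc j hj j hj]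
    simp only [e3]

/-- The event that every row `u ∈ N` has the same counts as `ρ u` in all blocks `B s`. -/
theorem prob_nbrCount_eq_le (h0 : 0 ≤ p) (h1 : p ≤ 1) (a : Sym2 V → Bool) (N J : Finset V)
    (ρ : V → V) (B : V → Finset V) (hρ : ∀ u ∈ N, ρ u ∉ N)
    (hB : ∀ s ∈ J, ∀ t ∈ J, s ≠ t → Disjoint (B s) (B t)) (hBN : ∀ s ∈ J, Disjoint (B s) N)
    {K C : ℝ} (hK : 1 ≤ K) (hC : 0 ≤ C)
    (hb : ∀ u ∈ N, ∀ s ∈ J, ∀ d, tiltedProb p K (flipSign a) (starAt u (B s)) d ≤ C) (m : ℝ) :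
    K ^ m * prob p (fun f => (∀ u ∈ N, ∀ s ∈ J,
        nbrCount (flipBy a f) (B s) u = nbrCount (flipBy a f) (B s) (ρ u)) ∧
        m ≤ ∑ u ∈ N, nbrCount f (J.biUnion B) u) ≤ C ^ (N.card * J.card) := by
  refine le_trans (mul_prob_le_expect h0 h1 ?_ _ ?_)
    (expect_prod_tilt_le h0 h1 a N J ρ B hρ hB hBN (zero_le_one.trans hK) hC hb)
  · intro f
    refine Finset.prod_nonneg fun j _ => mul_nonneg (tilt_nonneg (zero_le_one.trans hK) _ _) ?_
    split_ifs <;> norm_num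
  · rintro f ⟨hf, hm⟩
    have e : ∏ j ∈ N ×ˢ J, (tilt K (starAt j.1 (B j.2)) f *
        if nbrCount (flipBy a f) (B j.2) j.1 = nbrCount (flipBy a f) (B j.2) (ρ j.1)
          then (1 : ℝ) else 0) = K ^ ∑ u ∈ N, nbrCount f (J.biUnion B) u := by
      rw [Finset.prod_product, ← Finset.prod_pow_eq_pow_sum]
      refine Finset.prod_congr rfl fun u hu => ?_
      rw [nbrCount, ← Finset.prod_const, Finset.prod_filter, Finset.prod_biUnion hB]
      refine Finset.prod_congr rfl fun s hs => ?_
      rw [if_pos (hf u hu s hs), mul_one, tilt, prod_star]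
    rw [e, ← Real.rpow_natCast]
    refine Real.rpow_le_rpow_of_exponent_le hK ?_
    exact hm

end Blocks

section Equitable

variable {V : Type*} [DecidableEq V] [Fintype V]

/-- The fibre of `r` over `w`. -/
def fiber (r : V → V) (w : V) : Finset V := Finset.univ.filter fun x => r x = w

theorem mem_fiber {r : V → V} {w x : V} : x ∈ fiber r w ↔ r x = w := by simp [fiber]

/-- The classes of the map `r` onto class representatives form an equitable partition of the
graph with edge indicator `y`. -/
def Equitable (y : Sym2 V → Bool) (r : V → V) : Prop :=
  (∀ u, r (r u) = r u) ∧ ∀ u v, r u = r v → ∀ w,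
    nbrCount y ((fiber r w).erase u) u = nbrCount y ((fiber r w).erase v) v

variable {y : Sym2 V → Bool} {r : V → V}

theorem Equitable.nbrCount_fiber (h : Equitable y r) {u v w : V} (huv : r u = r v)
    (hw : r u ≠ w) : nbrCount y (fiber r w) u = nbrCount y (fiber r w) v := by
  have := h.2 u v huv w
  rwa [Finset.erase_eq_of_notMem (fun hu => hw (mem_fiber.1 hu)),
    Finset.erase_eq_of_notMem (fun hu => hw (huv.trans (mem_fiber.1 hu)))] at this

theorem Equitable.apply_eq (h : Equitable y r) {u v w : V} (huv : r u = r v)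
    (hw : ∀ x, r x = r w → x = w) (hu : u ≠ w) : y s(u, w) = y s(v, w) := by
  have hf : fiber r (r w) = {w} := by
    ext x
    rw [mem_fiber, Finset.mem_singleton]
    exact ⟨hw x, fun e => by rw [e]⟩
  have := h.nbrCount_fiber huv (w := r w) (fun e => hu (hw u e))
  rw [hf, nbrCount, nbrCount, Finset.filter_singleton, Finset.filter_singleton] at this
  cases h1 : y s(u, w) <;> cases h2 : y s(v, w) <;> simp_all

theorem Equitable.nbrCount_compl (h : Equitable y r) {u v : V} (huv : r u = r v) :
    nbrCount y (Finset.univ \ {u, v}) u = nbrCount y (Finset.univ \ {u, v}) v := by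
  rcases eq_or_ne u v with rfl | hne
  · rfl
  have hdeg : ∀ u, nbrCount y (Finset.univ.erase u) u =
      ∑ w, nbrCount y ((fiber r w).erase u) u := by
    intro u
    rw [nbrCount, Finset.card_eq_sum_card_fiberwise (f := r) (t := Finset.univ)
      (fun _ _ => Finset.mem_coe.2 (Finset.mem_univ _))]
    refine Finset.sum_congr rfl fun w _ => ?_
    rw [nbrCount]
    congr 1
    ext x
    simp only [Finset.mem_filter, Finset.mem_erase, mem_fiber, Finset.mem_univ]
    tauto
  have hsplit : ∀ u v : V, u ≠ v → nbrCount y (Finset.univ.erase u) u =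
      nbrCount y (Finset.univ \ {u, v}) u + if y s(u, v) then 1 else 0 := by
    intro u v hne
    have : Finset.univ.erase u = insert v (Finset.univ \ {u, v}) := by
      ext x
      by_cases hx : x = v <;> simp_all [eq_comm]
    rw [this, nbrCount, Finset.filter_insert, nbrCount]
    split_ifs
    · rw [Finset.card_insert_of_notMem (by simp)]
    · rfl
  have e1 := hsplit u v hne
  have e2 := hsplit v u hne.symm
  rw [Sym2.eq_swap, Finset.pair_comm] at e2
  have e3 : nbrCount y (Finset.univ.erase u) u = nbrCount y (Finset.univ.erase v) v := by
    rw [hdeg, hdeg]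
    exact Finset.sum_congr rfl fun w _ => h.2 u v huv w
  omega

end Equitable

theorem crEquiv_equivalence {V Ω : Type*} (G : SimpleGraph V) (c : V → Ω) (t : ℕ) :
    Equivalence (crEquiv G c t) := by
  induction t with
  | zero => exact ⟨fun _ => rfl, fun h => Eq.symm h, fun h h' => Eq.trans h h'⟩
  | succ t ih =>
    exact ⟨fun u => ⟨ih.refl u, fun _ => rfl⟩, fun h => ⟨ih.symm h.1, fun w => (h.2 w).symm⟩,
      fun h h' => ⟨ih.trans h.1 h'.1, fun w => (h.2 w).trans (h'.2 w)⟩⟩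

theorem crStable_equivalence {V Ω : Type*} (G : SimpleGraph V) (c : V → Ω) :
    Equivalence (crStable G c) :=
  ⟨fun u t => (crEquiv_equivalence G c t).refl u,
    fun h t => (crEquiv_equivalence G c t).symm (h t),
    fun h h' t => (crEquiv_equivalence G c t).trans (h t) (h' t)⟩

theorem crEquiv_antitone {V Ω : Type*} (G : SimpleGraph V) (c : V → Ω) {s t : ℕ} (hst : s ≤ t)
    {u v : V} (h : crEquiv G c t u v) : crEquiv G c s u v := by
  induction t, hst using Nat.le_induction with
  | base => exact h
  | succ t _ ih => exact ih h.1

theorem crStable_card_eq {V Ω : Type*} [Finite V] {G : SimpleGraph V} {c : V → Ω} {u v : V}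
    (h : crStable G c u v) (w : V) :
    Nat.card {x : V // G.Adj u x ∧ crStable G c x w} =
      Nat.card {x : V // G.Adj v x ∧ crStable G c x w} := by
  have hτ : ∀ q : V × V, ∃ t, crEquiv G c t q.1 q.2 → crStable G c q.1 q.2 := by
    intro q
    by_cases hq : crStable G c q.1 q.2
    · exact ⟨0, fun _ => hq⟩
    · rw [crStable, not_forall] at hq
      exact ⟨hq.choose, fun h => absurd h hq.choose_spec⟩
  choose τ hτ using hτ
  obtain ⟨t, ht⟩ := (Set.finite_range τ).bddAbove
  have hstab : ∀ x y, crEquiv G c t x y ↔ crStable G c x y := fun x y =>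
    ⟨fun hxy => hτ (x, y) (crEquiv_antitone G c (ht ⟨(x, y), rfl⟩) hxy), fun hxy => hxy t⟩
  have := (h (t + 1)).2 w
  simpa only [hstab] using this

open Classical in
theorem exists_equitable {n : ℕ} {G : SimpleGraph (Fin n)} {f : Sym2 (Fin n) → Bool}
    (h : ¬ ∀ u v : Fin n, crStableTrivial (symmDiffG G (graphOfFlip f)) u v → u = v) :
    ∃ r : Fin n → Fin n, Equitable (flipBy (fun e => decide (e ∈ G.edgeSet)) f) r ∧
      ∃ u, r u ≠ u := by
  set H := symmDiffG G (graphOfFlip f) with hH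
  have hadj : ∀ u v, H.Adj u v ↔
      v ≠ u ∧ flipBy (fun e => decide (e ∈ G.edgeSet)) f s(u, v) = true := by
    intro u v
    have hGs : G.Adj v u ↔ G.Adj u v := G.adj_comm v u
    by_cases huv : u = v
    · simp [huv]
    · have : s(v, u) = s(u, v) := Sym2.eq_swap
      by_cases hG : G.Adj u v <;> cases hf : f s(u, v) <;>
        simp [hH, symmDiffG, graphOfFlip, flipBy, huv, Ne.symm huv, hG, hf, this, hGs, Xor', Xor]
  have heq := crStable_equivalence H fun _ => (0 : ℕ)
  let S : Setoid (Fin n) := ⟨crStable H fun _ => (0 : ℕ), heq⟩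
  let r : Fin n → Fin n := fun u => (Quotient.mk S u).out
  have hr : ∀ u v, r u = r v ↔ crStable H (fun _ => (0 : ℕ)) u v := fun u v =>
    Quotient.out_inj.trans Quotient.eq
  have hrr : ∀ u, r (r u) = r u := fun u => (hr _ _).2 (Quotient.mk_out (s := S) u)
  refine ⟨r, ⟨hrr, fun u v huv w => ?_⟩, ?_⟩
  · by_cases hw : ∃ x, r x = w
    · obtain ⟨x, rfl⟩ := hw
      have hc : ∀ u, nbrCount (flipBy (fun e => decide (e ∈ G.edgeSet)) f)
          ((fiber r (r x)).erase u) u =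
          Nat.card {z // H.Adj u z ∧ crStable H (fun _ => (0 : ℕ)) z x} := by
        intro u
        rw [nbrCount, Nat.card_eq_fintype_card, Fintype.card_subtype]
        congr 1
        ext z
        simp only [Finset.mem_filter, Finset.mem_erase, mem_fiber, Finset.mem_univ, hadj, hr]
        tauto
      rw [hc, hc]
      exact crStable_card_eq ((hr u v).1 huv) x
    · have : fiber r w = ∅ := by
        ext x
        simp only [mem_fiber, Finset.notMem_empty, iff_false]
        exact fun e => hw ⟨x, e⟩
      simp [this, nbrCount]
  · by_contra hcon
    push Not at hcon
    refine h fun u v huv => ?_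
    have := (hr u v).2 huv
    rwa [hcon, hcon] at this

section SmallSupport

theorem prod_add_prod_compl_le {ι : Type*} [DecidableEq ι] {b : ℝ} (hb : 0 ≤ b) (α : ι → ℝ)
    (A : Finset ι) (hα : ∀ i ∈ A, α i ^ 2 + (1 - α i) ^ 2 ≤ b ^ 2) (hA : 2 ≤ A.card) :
    ∏ i ∈ A, α i + ∏ i ∈ A, (1 - α i) ≤ b ^ A.card := by
  have hsq : ∀ B : Finset ι, B.Nonempty → (∀ i ∈ B, α i ^ 2 + (1 - α i) ^ 2 ≤ b ^ 2) →
      (∏ i ∈ B, α i) ^ 2 + (∏ i ∈ B, (1 - α i)) ^ 2 ≤ (b ^ B.card) ^ 2 := by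
    intro B hB
    induction hB using Finset.Nonempty.cons_induction with
    | singleton i => simp
    | cons i B hi _ ih =>
      intro h
      have h1 := h i (Finset.mem_cons_self _ _)
      have h2 := ih fun j hj => h j (Finset.mem_cons_of_mem hj)
      rw [Finset.prod_cons, Finset.prod_cons, Finset.card_cons, pow_succ b, mul_pow (b ^ _)]
      have h3 := mul_le_mul h2 h1 (by positivity) (by positivity)
      have h4 : 0 ≤ (α i * ∏ i ∈ B, (1 - α i)) ^ 2 + ((1 - α i) * ∏ i ∈ B, α i) ^ 2 := by
        positivity
      nlinarith
  obtain ⟨i, hi⟩ : A.Nonempty := Finset.card_pos.1 (by omega)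
  have hc : (A.erase i).card + 1 = A.card := Finset.card_erase_add_one hi
  have h1 := hsq (A.erase i) (Finset.card_pos.1 (by omega))
    fun j hj => hα j (Finset.mem_of_mem_erase hj)
  have h2 := hα i hi
  rw [← Finset.mul_prod_erase A α hi, ← Finset.mul_prod_erase A (fun i => 1 - α i) hi, ← hc,
    pow_succ b]
  refine (abs_le_of_sq_le_sq' ?_ (by positivity)).2
  rw [mul_pow]
  have h3 := mul_le_mul h1 h2 (by positivity) (by positivity)
  nlinarith [sq_nonneg (α i * ∏ j ∈ A.erase i, (1 - α j) - (1 - α i) * ∏ j ∈ A.erase i, α j)]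

variable {V : Type*} [DecidableEq V] [Fintype V] {p : ℝ}

theorem prob_forall_apply_eq_le (h0 : 0 ≤ p) (h1 : p ≤ 1) (a : Sym2 V → Bool) (T : Finset V)
    (r : V → V) (hr : ∀ u ∈ T, ∃ v ∈ T, v ≠ u ∧ r v = r u) :
    prob p (fun f => ∀ u ∈ T, ∀ v ∈ T, r u = r v → ∀ w ∉ T,
      flipBy a f s(u, w) = flipBy a f s(v, w)) ≤
        Real.exp (-(p * (1 - p) * T.card * (Tᶜ).card)) := by
  set A : V → Finset V := fun c => T.filter fun u => r u = c with hA
  set h : V × V → (Sym2 V → Bool) → ℝ := fun j f =>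
    (∏ e ∈ starAt j.2 (A j.1), if flipBy a f e then (1 : ℝ) else 0) +
      ∏ e ∈ starAt j.2 (A j.1), if flipBy a f e then (0 : ℝ) else 1 with hh
  have hpos : ∀ j ∈ T.image r ×ˢ Tᶜ, ∀ f, 0 ≤ h j f := by
    intro j _ f
    refine add_nonneg (Finset.prod_nonneg fun e _ => ?_) (Finset.prod_nonneg fun e _ => ?_) <;>
      split_ifs <;> norm_num
  have hinv : ∀ i ∈ T.image r ×ˢ Tᶜ, ∀ j ∈ T.image r ×ˢ Tᶜ, i ≠ j → ∀ f g,
      h i ((starAt j.2 (A j.1)).piecewise g f) = h i f := by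
    rintro ⟨c, w⟩ hi ⟨c', w'⟩ hj hij f g
    rw [Finset.mem_product, Finset.mem_compl] at hi hj
    have hn : ∀ e ∈ starAt w (A c), e ∉ starAt w' (A c') := by
      intro e he he'
      obtain ⟨u, hu, rfl⟩ := Finset.mem_image.1 he
      obtain ⟨u', hu', e⟩ := Finset.mem_image.1 he'
      rw [hA, Finset.mem_filter] at hu hu'
      rcases Sym2.eq_iff.1 e with ⟨e1, e2⟩ | ⟨e1, e2⟩
      · exact hij (Prod.ext (by rw [← hu.2, ← hu'.2, e2]) e1.symm)
      · exact hi.2 (e2 ▸ hu'.1)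
    simp only [hh]
    congr 1 <;> refine Finset.prod_congr rfl fun e he => ?_ <;>
      rw [flipBy, flipBy, Finset.piecewise_eq_of_notMem _ _ _ (hn e he)]
  have hexp : ∀ (D : Finset (Sym2 V)), 2 ≤ D.card → ∀ f,
      expect p (fun g => (∏ e ∈ D, if flipBy a (D.piecewise g f) e then (1 : ℝ) else 0) +
        ∏ e ∈ D, if flipBy a (D.piecewise g f) e then (0 : ℝ) else 1) ≤
          Real.exp (-(p * (1 - p))) ^ D.card := by
    intro D hD f
    have e1 := expect_prod (p := p) D fun e b => if xor (a e) b then (1 : ℝ) else 0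
    have e2 := expect_prod (p := p) D fun e b => if xor (a e) b then (0 : ℝ) else 1
    have e3 := prod_add_prod_compl_le (Real.exp_pos (-(p * (1 - p)))).le
      (fun e => if a e then 1 - p else p) D (fun e _ => ?_) hD
    · refine le_trans (le_of_eq ?_) e3
      rw [expect_add]
      congr 1
      · refine Eq.trans ?_ (e1.trans (Finset.prod_congr rfl fun e _ => ?_))
        · congr 1
          funext g
          refine Finset.prod_congr rfl fun e he => ?_
          rw [flipBy, Finset.piecewise_eq_of_mem _ _ _ he]
        · cases a e <;> simp
      · refine Eq.trans ?_ (e2.trans (Finset.prod_congr rfl fun e _ => ?_))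
        · congr 1
          funext g
          refine Finset.prod_congr rfl fun e he => ?_
          rw [flipBy, Finset.piecewise_eq_of_mem _ _ _ he]
        · cases a e <;> simp
    · have e4 := Real.add_one_le_exp (-(2 * (p * (1 - p))))
      have e5 : Real.exp (-(p * (1 - p))) ^ 2 = Real.exp (-(2 * (p * (1 - p)))) := by
        rw [← Real.exp_nat_mul]
        congr 1
        push_cast
        ring
      rw [e5]
      split_ifs <;> nlinarith
  have key := expect_prod_le h0 h1 (T.image r ×ˢ Tᶜ) (fun j => starAt j.2 (A j.1)) h
    (fun j => Real.exp (-(p * (1 - p))) ^ (A j.1).card) hpos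
    (fun j _ => pow_nonneg (Real.exp_pos _).le _) hinv ?_
  · have e : ∏ j ∈ T.image r ×ˢ Tᶜ, Real.exp (-(p * (1 - p))) ^ (A j.1).card =
        Real.exp (-(p * (1 - p) * T.card * (Tᶜ).card)) := by
      rw [Finset.prod_pow_eq_pow_sum, ← Real.exp_nat_mul, Finset.sum_product]
      simp only [Finset.sum_const, smul_eq_mul]
      rw [← Finset.mul_sum, ← Finset.card_eq_sum_card_image]
      congr 1
      push_cast
      ring
    rw [e] at key
    refine le_trans ?_ key
    have hm := mul_prob_le_expect (p := p) h0 h1 (E := fun f => ∀ u ∈ T, ∀ v ∈ T, r u = r v →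
      ∀ w ∉ T, flipBy a f s(u, w) = flipBy a f s(v, w))
      (X := fun f => ∏ j ∈ T.image r ×ˢ Tᶜ, h j f)
      (fun f => Finset.prod_nonneg fun j hj => hpos j hj f) 1 ?_
    · rwa [one_mul] at hm
    · intro f hf
      rw [← Finset.prod_const_one (s := T.image r ×ˢ Tᶜ) (M := ℝ)]
      refine Finset.prod_le_prod (fun _ _ => zero_le_one) fun j hj => ?_
      obtain ⟨c, w⟩ := j
      rw [Finset.mem_product, Finset.mem_compl] at hj
      obtain ⟨u, hu, rfl⟩ := Finset.mem_image.1 hj.1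
      have hb : ∀ e ∈ starAt w (A (r u)), flipBy a f e = flipBy a f s(u, w) := by
        intro e he
        obtain ⟨v, hv, rfl⟩ := Finset.mem_image.1 he
        rw [hA, Finset.mem_filter] at hv
        rw [Sym2.eq_swap, hf v hv.1 u hu hv.2 w hj.2]
      simp only [hh]
      cases hy : flipBy a f s(u, w)
      · have h1 : ∏ e ∈ starAt w (A (r u)), (if flipBy a f e then (0 : ℝ) else 1) = 1 :=
          Finset.prod_eq_one fun e he => by simp [hb e he, hy]
        have : (0 : ℝ) ≤ ∏ e ∈ starAt w (A (r u)), if flipBy a f e then (1 : ℝ) else 0 :=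
          Finset.prod_nonneg fun e _ => by split_ifs <;> norm_num
        linarith
      · have h1 : ∏ e ∈ starAt w (A (r u)), (if flipBy a f e then (1 : ℝ) else 0) = 1 :=
          Finset.prod_eq_one fun e he => by simp [hb e he, hy]
        have : (0 : ℝ) ≤ ∏ e ∈ starAt w (A (r u)), if flipBy a f e then (0 : ℝ) else 1 :=
          Finset.prod_nonneg fun e _ => by split_ifs <;> norm_num
        linarith
  · rintro ⟨c, w⟩ hj f
    rw [← card_star w (A c)]
    refine hexp _ ?_ f
    rw [card_star]
    obtain ⟨u, hu, rfl⟩ := Finset.mem_image.1 (Finset.mem_product.1 hj).1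
    obtain ⟨v, hv, hvu, hrv⟩ := hr u hu
    exact Finset.one_lt_card.2 ⟨u, by simp [hA, hu], v, by simp [hA, hv, hrv], hvu.symm⟩

/-- The vertices lying in a class with at least two elements. -/
def nonsingletons (r : V → V) : Finset V := Finset.univ.filter fun u => ∃ v, v ≠ u ∧ r v = r u

/-- The vertices which do not represent their class. -/
def nonreps (r : V → V) : Finset V := Finset.univ.filter fun u => r u ≠ u

theorem card_nonsingletons_le (r : V → V) :
    (nonsingletons r).card ≤ 2 * (nonreps r).card := by
  have hsub : nonsingletons r ⊆ nonreps r ∪ (nonreps r).image r := by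
    intro u hu
    obtain ⟨v, hv, hvu⟩ := (Finset.mem_filter.1 hu).2
    rw [Finset.mem_union, Finset.mem_image]
    by_cases h : r u = u
    · refine Or.inr ⟨v, ?_, hvu.trans h⟩
      simp only [nonreps, Finset.mem_filter, Finset.mem_univ, true_and]
      rw [hvu, h]
      exact hv.symm
    · exact Or.inl (by simp [nonreps, h])
  have := (Finset.card_le_card hsub).trans (Finset.card_union_le _ _)
  have := Finset.card_image_le (s := nonreps r) (f := r)
  omega

theorem prob_small_nonsingletons_le (h0 : 0 ≤ p) (h1 : p ≤ 1) (a : Sym2 V → Bool) (m : ℝ)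
    (hm : Real.exp 1 * Fintype.card V * Real.exp (-(p * (1 - p) * (Fintype.card V - m))) ≤ 1 / 2) :
    prob p (fun f => ∃ r, Equitable (flipBy a f) r ∧ (nonsingletons r).Nonempty ∧
      ((nonsingletons r).card : ℝ) ≤ m) ≤
      2 * (Real.exp 1 * Fintype.card V * Real.exp (-(p * (1 - p) * (Fintype.card V - m)))) := by
  set n := Fintype.card V with hn
  set β := Real.exp (-(p * (1 - p) * (n - m))) with hβ
  set x := Real.exp 1 * n * β with hx
  have hx0 : 0 ≤ x := by positivity
  set P : Finset V → Finset (V → V) := fun T => Fintype.piFinset fun v => if v ∈ T then T else {v}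
  set I : Finset (Finset V) := (Finset.univ : Finset V).powerset.filter
    fun T => T.Nonempty ∧ (T.card : ℝ) ≤ m with hI
  set F : Finset V → (V → V) → (Sym2 V → Bool) → Prop := fun T r f =>
    (∀ u ∈ T, ∃ v ∈ T, v ≠ u ∧ r v = r u) ∧ ∀ u ∈ T, ∀ v ∈ T, r u = r v → ∀ w ∉ T,
      flipBy a f s(u, w) = flipBy a f s(v, w) with hF
  have hPcard : ∀ T, ((P T).card : ℝ) = (T.card : ℝ) ^ T.card := by
    intro T
    rw [Fintype.card_piFinset]
    have : ∀ v, (if v ∈ T then T else {v}).card = if v ∈ T then T.card else 1 := fun v => by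
      split_ifs <;> simp
    simp only [this, Fintype.prod_ite_mem, Finset.prod_const]
    push_cast
    rfl
  have hFle : ∀ T ∈ I, ∀ r, prob p (F T r) ≤ β ^ T.card := by
    intro T hT r
    have hTm : (T.card : ℝ) ≤ m := (Finset.mem_filter.1 hT).2.2
    by_cases hc : ∀ u ∈ T, ∃ v ∈ T, v ≠ u ∧ r v = r u
    · refine (prob_mono h0 h1 fun f hf => hf.2).trans
        ((prob_forall_apply_eq_le h0 h1 a T r hc).trans ?_)
      rw [hβ, ← Real.exp_nat_mul]
      refine Real.exp_le_exp.2 ?_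
      have hcc : (T.card : ℝ) + (Tᶜ).card = n := by
        exact_mod_cast Finset.card_add_card_compl T
      have hq : 0 ≤ p * (1 - p) * T.card :=
        mul_nonneg (mul_nonneg h0 (by linarith)) (Nat.cast_nonneg _)
      nlinarith
    · have : prob p (F T r) ≤ prob p fun _ => False := prob_mono h0 h1 fun f hf => hc hf.1
      refine this.trans ?_
      rw [prob]
      simp only [if_false, expect_const]
      positivity
  have hsub : ∀ f, (∃ r, Equitable (flipBy a f) r ∧ (nonsingletons r).Nonempty ∧
      ((nonsingletons r).card : ℝ) ≤ m) → ∃ T ∈ I, ∃ r ∈ P T, F T r f := by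
    rintro f ⟨r, hr, hne, hle⟩
    have hmem : ∀ {u}, u ∈ nonsingletons r ↔ ∃ v, v ≠ u ∧ r v = r u := by simp [nonsingletons]
    refine ⟨nonsingletons r, by simp [hI, hne, hle], r, ?_, ?_, ?_⟩
    · refine Fintype.mem_piFinset.2 fun u => ?_
      split_ifs with hu
      · by_cases h : r u = u
        · rwa [h]
        · exact hmem.2 ⟨u, fun e => h e.symm, (hr.1 u).symm⟩
      · rw [Finset.mem_singleton]
        by_contra h
        exact hu (hmem.2 ⟨r u, h, hr.1 u⟩)
    · intro u hu
      obtain ⟨v, hv, hvu⟩ := hmem.1 hu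
      exact ⟨v, hmem.2 ⟨u, hv.symm, hvu.symm⟩, hv, hvu⟩
    · intro u hu v _ huv w hw
      refine hr.apply_eq huv (fun z hz => ?_) (fun e => hw (e ▸ hu))
      by_contra hzw
      exact hw (hmem.2 ⟨z, hzw, hz⟩)
  have hterm : ∀ t : ℕ, (n.choose t : ℝ) * ((t : ℝ) ^ t * β ^ t) ≤ x ^ t := by
    intro t
    have e1 : (n.choose t : ℝ) ≤ n ^ t / t.factorial := Nat.choose_le_pow_div t n
    have e2 : (t : ℝ) ^ t / t.factorial ≤ Real.exp t :=
      Real.pow_div_factorial_le_exp t (Nat.cast_nonneg t) t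
    have e3 : Real.exp t = Real.exp 1 ^ t := by rw [← Real.exp_nat_mul, mul_one]
    calc (n.choose t : ℝ) * ((t : ℝ) ^ t * β ^ t)
        ≤ n ^ t / t.factorial * ((t : ℝ) ^ t * β ^ t) := by gcongr
      _ = (t : ℝ) ^ t / t.factorial * (n ^ t * β ^ t) := by ring
      _ ≤ Real.exp t * (n ^ t * β ^ t) := by gcongr
      _ = x ^ t := by rw [e3, hx, mul_pow, mul_pow, mul_assoc]
  calc prob p (fun f => ∃ r, Equitable (flipBy a f) r ∧ (nonsingletons r).Nonempty ∧
        ((nonsingletons r).card : ℝ) ≤ m)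
      ≤ prob p (fun f => ∃ T ∈ I, ∃ r ∈ P T, F T r f) := prob_mono h0 h1 hsub
    _ ≤ ∑ T ∈ I, prob p (fun f => ∃ r ∈ P T, F T r f) := prob_exists_le h0 h1 _ _
    _ ≤ ∑ T ∈ I, (T.card : ℝ) ^ T.card * β ^ T.card := by
        refine Finset.sum_le_sum fun T hT => (prob_exists_le h0 h1 _ _).trans ?_
        rw [← hPcard, ← nsmul_eq_mul]
        exact Finset.sum_le_card_nsmul _ _ _ fun r _ => hFle T hT r
    _ ≤ ∑ T ∈ (Finset.univ : Finset V).powerset,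
          if T.card = 0 then 0 else (T.card : ℝ) ^ T.card * β ^ T.card := by
        rw [hI, Finset.sum_filter]
        refine Finset.sum_le_sum fun T _ => ?_
        by_cases hT : T = ∅
        · simp [hT]
        · rw [if_neg (fun h => hT (Finset.card_eq_zero.1 h))]
          split_ifs
          · exact le_rfl
          · positivity
    _ = ∑ t ∈ Finset.range (n + 1), n.choose t • if t = 0 then 0 else (t : ℝ) ^ t * β ^ t :=
        Finset.sum_powerset_apply_card fun t => if t = 0 then (0 : ℝ) else (t : ℝ) ^ t * β ^ t
    _ ≤ ∑ t ∈ Finset.range n, x * x ^ t := by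
        rw [Finset.sum_range_succ', if_pos rfl, smul_zero, add_zero]
        refine Finset.sum_le_sum fun t _ => ?_
        rw [if_neg (Nat.succ_ne_zero t), nsmul_eq_mul, ← pow_succ']
        exact hterm (t + 1)
    _ ≤ 2 * x := by
        rw [← Finset.mul_sum, mul_comm]
        refine mul_le_mul_of_nonneg_right ?_ hx0
        calc ∑ t ∈ Finset.range n, x ^ t ≤ ∑ t ∈ Finset.range n, (1 / 2 : ℝ) ^ t := by gcongr
          _ ≤ 2 := sum_geometric_two_le n

end SmallSupport

section SmallClasses

theorem exists_subset_sum_mem_Icc {α : Type*} (c : α → ℝ) (x : ℝ) (S : Finset α)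
    (hc : ∀ s ∈ S, c s ≤ x) (hS : x ≤ ∑ s ∈ S, c s) :
    ∃ U ⊆ S, x ≤ ∑ s ∈ U, c s ∧ (U = ∅ ∨ ∑ s ∈ U, c s ≤ 2 * x) := by
  induction S using Finset.cons_induction with
  | empty => exact ⟨∅, subset_rfl, hS, Or.inl rfl⟩
  | cons a S ha ih =>
    by_cases h : x ≤ ∑ s ∈ S, c s
    · obtain ⟨U, hU, h'⟩ := ih (fun s hs => hc s (Finset.mem_cons_of_mem hs)) h
      exact ⟨U, hU.trans (Finset.subset_cons ha), h'⟩
    · refine ⟨Finset.cons a S ha, subset_rfl, hS, Or.inr ?_⟩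
      rw [Finset.sum_cons]
      linarith [hc a (Finset.mem_cons_self _ _)]

variable {V : Type*} [DecidableEq V] [Fintype V] {p : ℝ}

theorem disjoint_fiber (r : V → V) {s t : V} (h : s ≠ t) : Disjoint (fiber r s) (fiber r t) :=
  Finset.disjoint_left.2 fun x hs ht => h (by rw [← mem_fiber.1 hs, mem_fiber.1 ht])

theorem prob_sum_nbrCount_lt_le (h0 : 0 ≤ p) (h1 : p ≤ 1) {A B : Finset V} (hAB : Disjoint A B)
    {m : ℝ} (hm : m ≤ p * (A.card * B.card) / 4) :
    prob p (fun f => (∑ u ∈ A, nbrCount f B u : ℕ) < m) ≤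
      Real.exp (-(p * (A.card * B.card) / 4)) := by
  have hdisj : ∀ u ∈ A, ∀ v ∈ A, u ≠ v → Disjoint (starAt u B) (starAt v B) := by
    intro u hu v hv huv
    refine Finset.disjoint_left.2 fun e he he' => ?_
    obtain ⟨w, hw, rfl⟩ := Finset.mem_image.1 he
    obtain ⟨w', hw', e⟩ := Finset.mem_image.1 he'
    rcases Sym2.eq_iff.1 e with ⟨e1, e2⟩ | ⟨e1, e2⟩
    · exact huv e1.symm
    · exact Finset.disjoint_left.1 hAB hu (e2 ▸ hw')
  have hcard : (A.biUnion fun u => starAt u B).card = A.card * B.card := by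
    rw [Finset.card_biUnion hdisj]
    simp only [card_star, Finset.sum_const, smul_eq_mul]
  have hexp : expect p (tilt (1 / 2) (A.biUnion fun u => starAt u B)) ≤
      Real.exp (-(p * (A.card * B.card) / 2)) := by
    have h := expect_prod (p := p) (A.biUnion fun u => starAt u B)
      fun _ b => if b then (1 / 2 : ℝ) else 1
    simp only [if_true, Bool.false_eq_true, if_false, Finset.prod_const, hcard] at h
    refine h.le.trans ?_
    calc (p * (1 / 2) + (1 - p) * 1) ^ (A.card * B.card)
        ≤ Real.exp (-(p / 2)) ^ (A.card * B.card) := by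
          gcongr
          linarith [Real.add_one_le_exp (-(p / 2))]
      _ = _ := by
          rw [← Real.exp_nat_mul]
          congr 1
          push_cast
          ring
  have hmk := mul_prob_le_expect h0 h1 (E := fun f => (∑ u ∈ A, nbrCount f B u : ℕ) < m)
    (X := tilt (1 / 2) (A.biUnion fun u => starAt u B))
    (fun f => tilt_nonneg (by norm_num) _ f) (Real.exp (-m)) ?_
  · rw [← le_div_iff₀' (Real.exp_pos _)] at hmk
    refine hmk.trans ((div_le_div_of_nonneg_right hexp (Real.exp_pos _).le).trans ?_)
    rw [← Real.exp_sub]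
    refine Real.exp_le_exp.2 ?_
    linarith
  · intro f hf
    have e : tilt (1 / 2) (A.biUnion fun u => starAt u B) f =
        (1 / 2 : ℝ) ^ ∑ u ∈ A, nbrCount f B u := by
      rw [tilt, Finset.prod_biUnion hdisj, ← Finset.prod_pow_eq_pow_sum]
      refine Finset.prod_congr rfl fun u _ => ?_
      rw [prod_star, nbrCount, ← Finset.prod_const, Finset.prod_filter]
    rw [e]
    have h2 : Real.exp (-1) ≤ 1 / 2 := by
      rw [Real.exp_neg, ← one_div]
      exact one_div_le_one_div_of_le (by norm_num) (by linarith [Real.add_one_le_exp 1])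
    calc Real.exp (-m) ≤ Real.exp (-((∑ u ∈ A, nbrCount f B u : ℕ) : ℝ)) :=
          Real.exp_le_exp.2 (by linarith)
      _ = Real.exp (-1) ^ ∑ u ∈ A, nbrCount f B u := by
          rw [← Real.exp_nat_mul]
          congr 1
          ring
      _ ≤ _ := by gcongr

/-- The vertices in classes so small that a given vertex rarely sees a flip in it. -/
noncomputable def inSmallClass (p K : ℝ) (r : V → V) : Finset V :=
  Finset.univ.filter fun u => K ^ 2 * p * (fiber r (r u)).card ≤ 1

theorem exists_small_classes {K δ : ℝ} {r : V → V} (hδ : 0 < δ * Fintype.card V)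
    (hN : δ * Fintype.card V ≤ (nonreps r).card)
    (hX : δ * Fintype.card V ≤ (inSmallClass p K r).card)
    (hc : ∀ b : ℕ, K ^ 2 * p * b ≤ 1 → (b : ℝ) ≤ δ * Fintype.card V / 4) :
    ∃ U : Finset V, (∀ s ∈ U, K ^ 2 * p * (fiber r s).card ≤ 1) ∧
      δ * Fintype.card V / 4 ≤ (U.biUnion (fiber r)).card ∧
      δ * Fintype.card V / 2 ≤ ((nonreps r).filter fun u => r u ∉ U).card := by
  set x := δ * Fintype.card V with hx
  have hS : ∀ s ∈ (inSmallClass p K r).image r, K ^ 2 * p * (fiber r s).card ≤ 1 := by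
    intro s hs
    obtain ⟨u, hu, rfl⟩ := Finset.mem_image.1 hs
    exact (Finset.mem_filter.1 hu).2
  have hcard : ∀ U : Finset V,
      ((U.biUnion (fiber r)).card : ℝ) = ∑ s ∈ U, ((fiber r s).card : ℝ) := by
    intro U
    rw [Finset.card_biUnion fun s _ t _ hst => disjoint_fiber r hst]
    push_cast
    rfl
  obtain ⟨U, hU, h1, h2⟩ := exists_subset_sum_mem_Icc (fun s => ((fiber r s).card : ℝ)) (x / 4)
    ((inSmallClass p K r).image r) (fun s hs => hc _ (hS s hs)) (by
      rw [← hcard]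
      have : inSmallClass p K r ⊆ ((inSmallClass p K r).image r).biUnion (fiber r) := fun u hu =>
        Finset.mem_biUnion.2 ⟨r u, Finset.mem_image_of_mem r hu, mem_fiber.2 rfl⟩
      have : ((inSmallClass p K r).card : ℝ) ≤
        (((inSmallClass p K r).image r).biUnion (fiber r)).card := by
          exact_mod_cast Finset.card_le_card this
      linarith)
  refine ⟨U, fun s hs => hS s (hU hs), (hcard U).symm ▸ h1, ?_⟩
  have h3 : ((U.biUnion (fiber r)).card : ℝ) ≤ x / 2 := by
    rcases h2 with rfl | h2
    · simp only [Finset.biUnion_empty, Finset.card_empty, Nat.cast_zero]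
      linarith
    · rw [hcard]
      linarith
  have h4 : nonreps r ⊆ ((nonreps r).filter fun u => r u ∉ U) ∪ U.biUnion (fiber r) := by
    intro u hu
    by_cases h : r u ∈ U
    · exact Finset.mem_union_right _ (Finset.mem_biUnion.2 ⟨r u, h, mem_fiber.2 rfl⟩)
    · exact Finset.mem_union_left _ (Finset.mem_filter.2 ⟨hu, h⟩)
  have h5 : ((nonreps r).card : ℝ) ≤ ((nonreps r).filter fun u => r u ∉ U).card +
      (U.biUnion (fiber r)).card := by
    exact_mod_cast (Finset.card_le_card h4).trans (Finset.card_union_le _ _)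
  linarith

theorem prob_many_in_small_classes_le (h0 : 0 ≤ p) (h1 : p ≤ 1) (a : Sym2 V → Bool) {K δ : ℝ}
    (hK : 1 ≤ K) (hδ : 0 < δ * Fintype.card V)
    (hc : ∀ b : ℕ, K ^ 2 * p * b ≤ 1 → (b : ℝ) ≤ δ * Fintype.card V / 4) :
    prob p (fun f => ∃ r, Equitable (flipBy a f) r ∧ δ * Fintype.card V ≤ (nonreps r).card ∧
      δ * Fintype.card V ≤ (inSmallClass p K r).card) ≤
      2 ^ Fintype.card V * 2 ^ Fintype.card V * Real.exp (-(p * (δ * Fintype.card V) ^ 2 / 32)) +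
      Fintype.card V ^ Fintype.card V * 2 ^ Fintype.card V *
        K ^ (-(p * (δ * Fintype.card V) ^ 2 / 32)) := by
  set x := δ * Fintype.card V with hx
  set m := p * x ^ 2 / 32 with hm
  have hK0 : 0 < K := zero_lt_one.trans_le hK
  set I : Finset (Finset V × Finset V) := Finset.univ.filter fun q =>
    Disjoint q.1 q.2 ∧ x ^ 2 / 8 ≤ q.1.card * q.2.card with hI
  set N : (V → V) × Finset V → Finset V := fun q => (nonreps q.1).filter fun u => q.1 u ∉ q.2
    with hN
  set W : (V → V) × Finset V → Finset V := fun q => q.2.biUnion (fiber q.1) with hW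
  have hNW : ∀ q, ∀ s ∈ q.2, Disjoint (fiber q.1 s) (N q) := by
    intro q s hs
    refine Finset.disjoint_left.2 fun u hu hu' => (Finset.mem_filter.1 hu').2 ?_
    rwa [mem_fiber.1 hu]
  set F : (V → V) × Finset V → (Sym2 V → Bool) → Prop := fun q f =>
    ((∀ u, q.1 (q.1 u) = q.1 u) ∧ ∀ s ∈ q.2, K ^ 2 * p * (fiber q.1 s).card ≤ 1) ∧
    (∀ u ∈ N q, ∀ s ∈ q.2,
      nbrCount (flipBy a f) (fiber q.1 s) u = nbrCount (flipBy a f) (fiber q.1 s) (q.1 u)) ∧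
    m ≤ (∑ u ∈ N q, nbrCount f (W q) u : ℕ) with hF
  have hsub : ∀ f, (∃ r, Equitable (flipBy a f) r ∧ x ≤ (nonreps r).card ∧
      x ≤ (inSmallClass p K r).card) →
      (∃ q ∈ I, (∑ u ∈ q.1, nbrCount f q.2 u : ℕ) < m) ∨ ∃ q ∈ Finset.univ, F q f := by
    rintro f ⟨r, hr, hr1, hr2⟩
    obtain ⟨U, hU, hU1, hU2⟩ := exists_small_classes hδ hr1 hr2 hc
    by_cases hlt : ((∑ u ∈ N (r, U), nbrCount f (W (r, U)) u : ℕ) : ℝ) < m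
    · refine Or.inl ⟨(N (r, U), W (r, U)), ?_, hlt⟩
      rw [hI, Finset.mem_filter]
      refine ⟨Finset.mem_univ _, ?_, ?_⟩
      · exact ((Finset.disjoint_biUnion_left _ _ _).2 fun s hs => hNW (r, U) s hs).symm
      · have := mul_le_mul hU2 hU1 (by positivity) (by positivity)
        refine le_trans (le_of_eq ?_) this
        ring
    · refine Or.inr ⟨(r, U), Finset.mem_univ _, ⟨hr.1, hU⟩, fun u hu s hs => ?_, not_lt.1 hlt⟩
      exact hr.nbrCount_fiber (hr.1 u).symm fun e => (Finset.mem_filter.1 hu).2 (e.symm ▸ hs : r u ∈ U)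
  have hI1 : ∀ q ∈ I, prob p (fun f => (∑ u ∈ q.1, nbrCount f q.2 u : ℕ) < m) ≤
      Real.exp (-m) := by
    intro q hq
    obtain ⟨_, hd, hq⟩ := Finset.mem_filter.1 hq
    have e : m ≤ p * (q.1.card * q.2.card) / 4 := by
      rw [hm]
      nlinarith
    exact (prob_sum_nbrCount_lt_le h0 h1 hd e).trans (Real.exp_le_exp.2 (by linarith))
  have hF1 : ∀ q ∈ (Finset.univ : Finset ((V → V) × Finset V)), prob p (F q) ≤ K ^ (-m) := by
    rintro ⟨r, U⟩ _
    by_cases hq : (∀ u, r (r u) = r u) ∧ ∀ s ∈ U, K ^ 2 * p * (fiber r s).card ≤ 1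
    · have := prob_nbrCount_eq_le h0 h1 a (N (r, U)) U r (fiber r) (fun u _ hu => ?_)
        (fun s _ t _ hst => disjoint_fiber r hst) (hNW (r, U)) hK zero_le_one
        (fun u _ s hs d => (tiltedProb_le_one_and h0 h1 hK _ (fun e => ?_) _ ?_ d).1) m
      · rw [one_pow, ← le_div_iff₀' (by positivity)] at this
        refine (prob_mono h0 h1 fun f hf => hf.2).trans (this.trans ?_)
        rw [Real.rpow_neg hK0.le, one_div]
      · exact (Finset.mem_filter.1 (Finset.mem_filter.1 hu).1).2 (hq.1 u)
      · rcases flipSign_eq a e with h | h <;> rw [h] <;> norm_num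
      · rw [card_star]
        exact hq.2 s hs
    · have : prob p (F (r, U)) ≤ prob p fun _ => False := prob_mono h0 h1 fun f hf => hq hf.1
      refine this.trans ?_
      rw [prob]
      simp only [if_false, expect_const]
      positivity
  refine (prob_mono h0 h1 hsub).trans ((prob_or_le h0 h1 _ _).trans (add_le_add ?_ ?_))
  · refine (prob_exists_le h0 h1 _ _).trans ((Finset.sum_le_card_nsmul _ _ _ hI1).trans ?_)
    rw [nsmul_eq_mul]
    refine mul_le_mul_of_nonneg_right ?_ (Real.exp_pos _).le
    have : I.card ≤ 2 ^ Fintype.card V * 2 ^ Fintype.card V := by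
      refine (Finset.card_filter_le _ _).trans (le_of_eq ?_)
      rw [Finset.card_univ, Fintype.card_prod, Fintype.card_finset]
    exact_mod_cast this
  · refine (prob_exists_le h0 h1 _ _).trans ((Finset.sum_le_card_nsmul _ _ _ hF1).trans ?_)
    rw [nsmul_eq_mul, Finset.card_univ, Fintype.card_prod, Fintype.card_finset, Fintype.card_fun]
    push_cast
    exact le_rfl

end SmallClasses

section LargeClasses

variable {V : Type*} [DecidableEq V] [Fintype V] {p : ℝ}

theorem prob_nbrCount_compl_eq_le (h0 : 0 ≤ p) (h1 : p ≤ 1) (a : Sym2 V → Bool) {η : ℝ}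
    (hη : 0 ≤ η) {u v : V} (huv : u ≠ v)
    (h : ∀ d, tiltedProb p 1 (flipSign a) (starAt u (Finset.univ \ {u, v})) d ≤ η) :
    prob p (fun f => nbrCount (flipBy a f) (Finset.univ \ {u, v}) u =
      nbrCount (flipBy a f) (Finset.univ \ {u, v}) v) ≤ η := by
  have := prob_nbrCount_eq_le h0 h1 a {u} {u} (fun _ => v) (fun _ => Finset.univ \ {u, v})
    (fun _ _ => by simpa using huv.symm)
    (fun s hs t ht hst => absurd ((Finset.mem_singleton.1 hs).trans
      (Finset.mem_singleton.1 ht).symm) hst)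
    (fun _ _ => by simp) le_rfl hη
    (fun w hw _ _ d => by rw [Finset.mem_singleton.1 hw]; exact h d) 0
  rw [Real.one_rpow, one_mul, Finset.card_singleton, mul_one, pow_one] at this
  refine (prob_mono h0 h1 fun f hf => ⟨fun w hw _ _ => ?_, by positivity⟩).trans this
  rw [Finset.mem_singleton.1 hw]
  exact hf

theorem sq_mul_prob_large_class_le (h0 : 0 ≤ p) (h1 : p ≤ 1) (a : Sym2 V → Bool) {η x : ℝ}
    (hη : 0 ≤ η) (hx : 0 ≤ x)
    (h : ∀ u v, u ≠ v → ∀ d,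
      tiltedProb p 1 (flipSign a) (starAt u (Finset.univ \ {u, v})) d ≤ η) :
    x ^ 2 * prob p (fun f => ∃ r, Equitable (flipBy a f) r ∧ ∃ w, x < (fiber r w).card) ≤
      Fintype.card V + Fintype.card V ^ 2 * η := by
  classical
  set E : V × V → (Sym2 V → Bool) → Prop := fun q f =>
    nbrCount (flipBy a f) (Finset.univ \ {q.1, q.2}) q.1 =
      nbrCount (flipBy a f) (Finset.univ \ {q.1, q.2}) q.2 with hE
  have hE0 : ∀ q f, (0 : ℝ) ≤ if E q f then 1 else 0 := fun q f => by split_ifs <;> norm_num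
  refine (mul_prob_le_expect h0 h1 (X := fun f => ∑ q : V × V, if E q f then (1 : ℝ) else 0)
    (fun f => Finset.sum_nonneg fun q _ => hE0 q f) (x ^ 2) ?_).trans ?_
  · rintro f ⟨r, hr, w, hw⟩
    calc x ^ 2 ≤ ((fiber r w).card : ℝ) ^ 2 := by gcongr
      _ = ∑ q ∈ fiber r w ×ˢ fiber r w, (1 : ℝ) := by
          rw [Finset.sum_const, Finset.card_product, nsmul_eq_mul]
          push_cast
          ring
      _ ≤ ∑ q ∈ fiber r w ×ˢ fiber r w, if E q f then (1 : ℝ) else 0 := by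
          refine Finset.sum_le_sum fun q hq => ?_
          rw [Finset.mem_product, mem_fiber, mem_fiber] at hq
          rw [if_pos (hr.nbrCount_compl (hq.1.trans hq.2.symm))]
      _ ≤ _ := Finset.sum_le_sum_of_subset_of_nonneg (Finset.subset_univ _) fun q _ _ => hE0 q f
  · rw [expect_sum]
    have : ∀ q : V × V, expect p (fun f => if E q f then (1 : ℝ) else 0) ≤
        (if q.1 = q.2 then 1 else 0) + η := by
      rintro ⟨u, v⟩
      by_cases huv : u = v
      · subst huv
        simp only [hE, if_true, expect_const]
        linarith
      · have := prob_nbrCount_compl_eq_le h0 h1 a hη huv (h u v huv)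
        rw [prob] at this
        simp only [huv, if_false, zero_add]
        refine le_trans (le_of_eq ?_) this
        congr 1
        funext f
        congr
    refine (Finset.sum_le_sum fun q _ => this q).trans (le_of_eq ?_)
    rw [Finset.sum_add_distrib, Fintype.sum_prod_type]
    simp [sq, Fintype.card_prod]

theorem exists_large_classes {K : ℝ} {M : ℕ} {r : V → V} (hV : 0 < Fintype.card V) (hM : 2 ≤ M)
    (hKp : K ^ 2 * p ≤ 1 / 8)
    (hfib : ∀ w, 2 * M * (fiber r w).card ≤ Fintype.card V)
    (hsmall : 2 * (inSmallClass p K r).card ≤ Fintype.card V) :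
    ∃ S Y U : Finset V, U ⊆ S ∧ M ≤ S.card ∧ S.card ≤ 4 * U.card ∧ (∀ u ∈ Y, r u ∈ S) ∧
      (∀ s ∈ S, fiber r s ⊆ Y ∧ 1 < K ^ 2 * p * (fiber r s).card) ∧
      Fintype.card V ≤ 8 * ((Y \ S).filter fun u => r u ∉ U).card := by
  set n := Fintype.card V
  set Y : Finset V := Finset.univ \ inSmallClass p K r with hY
  have hmemY : ∀ u, u ∈ Y ↔ 1 < K ^ 2 * p * (fiber r (r u)).card := fun u => by
    simp [hY, inSmallClass]
  set S := Y.image r with hS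
  have hYS : ∀ u ∈ Y, r u ∈ S := fun u hu => Finset.mem_image_of_mem r hu
  have hfY : ∀ s ∈ S, fiber r s ⊆ Y ∧ 1 < K ^ 2 * p * (fiber r s).card := by
    intro s hs
    obtain ⟨u, hu, rfl⟩ := Finset.mem_image.1 hs
    refine ⟨fun v hv => ?_, (hmemY u).1 hu⟩
    rw [hmemY, mem_fiber.1 hv]
    exact (hmemY u).1 hu
  have hsum : ∑ s ∈ S, (fiber r s).card = Y.card := by
    rw [hS, Finset.card_eq_sum_card_image r Y]
    refine Finset.sum_congr rfl fun s hs => ?_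
    congr 1
    ext v
    rw [Finset.mem_filter, mem_fiber]
    exact ⟨fun h => ⟨(hfY s hs).1 (mem_fiber.2 h), h⟩, fun h => h.2⟩
  have hYn : Y.card ≤ n := Finset.card_le_univ _
  have hYcard : n ≤ 2 * Y.card := by
    have : Y.card + (inSmallClass p K r).card = n := by
      rw [hY]
      exact Finset.card_sdiff_add_card_eq_card (Finset.subset_univ _)
    omega
  have hMk : M ≤ S.card := by
    have e : 2 * M * Y.card ≤ S.card * n := by
      rw [← hsum, Finset.mul_sum, ← smul_eq_mul]
      exact Finset.sum_le_card_nsmul _ _ _ fun s _ => hfib s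
    have : M * n ≤ S.card * n := by nlinarith
    exact Nat.le_of_mul_le_mul_right this hV
  have hk8 : 8 * S.card ≤ n := by
    have e : (S.card : ℝ) ≤ K ^ 2 * p * Y.card := by
      rw [← hsum]
      push_cast
      rw [Finset.mul_sum, Finset.cast_card]
      exact Finset.sum_le_sum fun s hs => (hfY s hs).2.le
    have e2 : (Y.card : ℝ) ≤ n := by exact_mod_cast hYn
    have : (8 * S.card : ℝ) ≤ n := by nlinarith
    exact_mod_cast this
  obtain ⟨U, hU, hU4, hUsum⟩ : ∃ U ⊆ S, S.card ≤ 4 * U.card ∧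
      2 * ∑ s ∈ U, (fiber r s).card ≤ Y.card := by
    obtain ⟨S₁, hS₁, hc⟩ := Finset.exists_subset_card_eq (Nat.div_le_self S.card 2)
    have e := Finset.sum_sdiff hS₁ (f := fun s => (fiber r s).card)
    have e2 := Finset.card_sdiff_add_card_eq_card hS₁
    rw [hsum] at e
    by_cases h : 2 * ∑ s ∈ S₁, (fiber r s).card ≤ Y.card
    · exact ⟨S₁, hS₁, by omega, h⟩
    · exact ⟨S \ S₁, Finset.sdiff_subset, by omega, by omega⟩
  refine ⟨S, Y, U, hU, hMk, hU4, hYS, hfY, ?_⟩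
  have hcov : Y ⊆ ((Y \ S).filter fun u => r u ∉ U) ∪ S ∪ U.biUnion (fiber r) := by
    intro u hu
    simp only [Finset.mem_union, Finset.mem_filter, Finset.mem_sdiff, Finset.mem_biUnion, mem_fiber]
    by_cases h1 : u ∈ S
    · exact Or.inl (Or.inr h1)
    · by_cases h2 : r u ∈ U
      · exact Or.inr ⟨r u, h2, rfl⟩
      · exact Or.inl (Or.inl ⟨⟨hu, h1⟩, h2⟩)
  have e1 := Finset.card_le_card hcov
  have e2 := Finset.card_union_le (((Y \ S).filter fun u => r u ∉ U) ∪ S) (U.biUnion (fiber r))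
  have e3 := Finset.card_union_le ((Y \ S).filter fun u => r u ∉ U) S
  have e4 := Finset.card_biUnion_le (s := U) (t := fiber r)
  omega

theorem prob_few_in_small_classes_le (hV : 0 < Fintype.card V) (h0 : 0 ≤ p) (h1 : p ≤ 1 / 2)
    (a : Sym2 V → Bool) {K κ : ℝ} {M : ℕ} (hK : 1 ≤ K) (hκ0 : 0 ≤ κ)
    (hκ : 1 / 2 + Real.exp (-(2 / K ^ 2)) / 2 ≤ Real.exp (-κ)) (hM : 2 ≤ M)
    (hMκ : ∀ k : ℕ, M ≤ k → k * Real.exp (-(κ * k / 32)) ≤ 1 / 16) (hKp : K ^ 2 * p ≤ 1 / 8) :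
    prob p (fun f => ∃ r, Equitable (flipBy a f) r ∧
      (∀ w, 2 * M * (fiber r w).card ≤ Fintype.card V) ∧
      2 * (inSmallClass p K r).card ≤ Fintype.card V) ≤ (1 / 2) ^ Fintype.card V := by
  set n := Fintype.card V with hn
  have h1' : p ≤ 1 := by linarith
  set N : Finset V → Finset V × Finset V → (V → V) → Finset V := fun S q c =>
    (q.1 \ S).filter fun u => c u ∉ q.2 with hN
  set B : Finset V × Finset V → (V → V) → V → Finset V := fun q c s =>
    q.1.filter fun v => c v = s with hB
  set P : Finset V → Finset V × Finset V → Finset (V → V) := fun S q =>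
    Fintype.piFinset fun v => if v ∈ q.1 then S else {v} with hP
  set F : Finset V → Finset V × Finset V → (V → V) → (Sym2 V → Bool) → Prop := fun S q c f =>
    (S.card ≤ 4 * q.2.card ∧ n ≤ 8 * (N S q c).card ∧
      ∀ s ∈ q.2, 1 < K ^ 2 * p * (B q c s).card) ∧
    ∀ u ∈ N S q c, ∀ s ∈ q.2,
      nbrCount (flipBy a f) (B q c s) u = nbrCount (flipBy a f) (B q c s) (c u) with hF
  set I : Finset (Finset V) := Finset.univ.filter fun S => M ≤ S.card with hI
  have hsub : ∀ f, (∃ r, Equitable (flipBy a f) r ∧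
      (∀ w, 2 * M * (fiber r w).card ≤ Fintype.card V) ∧
      2 * (inSmallClass p K r).card ≤ Fintype.card V) →
      ∃ S ∈ I, ∃ q ∈ Finset.univ, ∃ c ∈ P S q, F S q c f := by
    rintro f ⟨r, hr, hfib, hsmall⟩
    obtain ⟨S, Y, U, hUS, hMS, hSU, hYS, hSY, hcard⟩ :=
      exists_large_classes hV hM hKp hfib hsmall
    have hc : ∀ u ∈ Y, Y.piecewise r id u = r u := fun u hu => Finset.piecewise_eq_of_mem _ _ _ hu
    have hNc : N S (Y, U) (Y.piecewise r id) = (Y \ S).filter fun u => r u ∉ U :=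
      Finset.filter_congr fun u hu => by rw [hc u (Finset.mem_sdiff.1 hu).1]
    have hBc : ∀ s ∈ S, B (Y, U) (Y.piecewise r id) s = fiber r s := by
      intro s hs
      ext v
      rw [hB, Finset.mem_filter, mem_fiber]
      constructor
      · rintro ⟨hv, e⟩
        rwa [hc v hv] at e
      · intro e
        have hv := (hSY s hs).1 (mem_fiber.2 e)
        exact ⟨hv, by rwa [hc v hv]⟩
    refine ⟨S, by simp [hI, hMS], (Y, U), Finset.mem_univ _, Y.piecewise r id, ?_,
      ⟨hSU, by rwa [hNc], fun s hs => ?_⟩, fun u hu s hs => ?_⟩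
    · refine Fintype.mem_piFinset.2 fun v => ?_
      by_cases hv : v ∈ Y
      · simp only [hv, if_true, Finset.piecewise_eq_of_mem]
        exact hYS v hv
      · simp [hv]
    · rw [hBc s (hUS hs)]
      exact (hSY s (hUS hs)).2
    · rw [hNc, Finset.mem_filter, Finset.mem_sdiff] at hu
      rw [hBc s (hUS hs), hc u hu.1.1]
      exact hr.nbrCount_fiber (hr.1 u).symm fun e => hu.2 (e.symm ▸ hs)
  have hF1 : ∀ S q, ∀ c ∈ P S q, prob p (F S q c) ≤ Real.exp (-(κ * S.card / 32)) ^ n := by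
    rintro S ⟨Y, U⟩ c hc
    by_cases hq : S.card ≤ 4 * U.card ∧ n ≤ 8 * (N S (Y, U) c).card ∧
      ∀ s ∈ U, 1 < K ^ 2 * p * (B (Y, U) c s).card
    · have hcS : ∀ u ∈ N S (Y, U) c, c u ∉ N S (Y, U) c := by
        intro u hu hu'
        have h3 := Fintype.mem_piFinset.1 hc u
        have h4 := (Finset.mem_sdiff.1 (Finset.mem_filter.1 hu).1).1
        simp only [h4, if_true] at h3
        exact (Finset.mem_sdiff.1 (Finset.mem_filter.1 hu').1).2 h3
      have hBd : ∀ s ∈ U, ∀ t ∈ U, s ≠ t → Disjoint (B (Y, U) c s) (B (Y, U) c t) :=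
        fun s _ t _ hst => Finset.disjoint_left.2 fun v hv hv' =>
          hst (by rw [← (Finset.mem_filter.1 hv).2, ← (Finset.mem_filter.1 hv').2])
      have hBN : ∀ s ∈ U, Disjoint (B (Y, U) c s) (N S (Y, U) c) := fun s hs =>
        Finset.disjoint_left.2 fun v hv hv' =>
          (Finset.mem_filter.1 hv').2 ((Finset.mem_filter.1 hv).2.symm ▸ hs)
      have hb : ∀ u ∈ N S (Y, U) c, ∀ s ∈ U, ∀ d,
          tiltedProb p 1 (flipSign a) (starAt u (B (Y, U) c s)) d ≤ Real.exp (-κ) := by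
        intro u _ s hs d
        refine (tiltedProb_one_le_parity h0 h1 _ (flipSign_eq a) _ d).trans (le_trans ?_ hκ)
        rw [card_star]
        have h5 : 2 / K ^ 2 ≤ 2 * (p * (B (Y, U) c s).card) := by
          rw [div_le_iff₀ (by positivity)]
          have := hq.2.2 s hs
          nlinarith
        have := Real.exp_le_exp.2 (neg_le_neg h5)
        linarith
      have := prob_nbrCount_eq_le h0 h1' a (N S (Y, U) c) U c (B (Y, U) c) hcS hBd hBN le_rfl
        (Real.exp_pos _).le hb 0
      rw [Real.one_rpow, one_mul] at this
      refine (prob_mono h0 h1' fun f hf => ⟨hf.2, by positivity⟩).trans (this.trans ?_)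
      rw [← Real.exp_nat_mul, ← Real.exp_nat_mul]
      refine Real.exp_le_exp.2 ?_
      have h6 : n * S.card ≤ 8 * (N S (Y, U) c).card * (4 * U.card) :=
        Nat.mul_le_mul hq.2.1 hq.1
      have h7 : (n * S.card : ℝ) ≤ 8 * (N S (Y, U) c).card * (4 * U.card) := by exact_mod_cast h6
      push_cast
      nlinarith
    · have : prob p (F S (Y, U) c) ≤ prob p fun _ => False :=
        prob_mono h0 h1' fun f hf => hq hf.1
      refine this.trans ?_
      rw [prob]
      simp only [if_false, expect_const]
      positivity
  have hPcard : ∀ S ∈ I, ∀ q, ((P S q).card : ℝ) ≤ (S.card : ℝ) ^ n := by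
    intro S hS q
    have h8 : 1 ≤ S.card := by
      have := (Finset.mem_filter.1 hS).2
      omega
    have : (P S q).card ≤ S.card ^ n := by
      rw [Fintype.card_piFinset, hn, ← Finset.card_univ, ← Finset.prod_const]
      refine Finset.prod_le_prod' fun v _ => ?_
      split_ifs
      · exact le_rfl
      · simpa using h8
    exact_mod_cast this
  calc _ ≤ prob p (fun f => ∃ S ∈ I, ∃ q ∈ Finset.univ, ∃ c ∈ P S q, F S q c f) :=
        prob_mono h0 h1' hsub
    _ ≤ ∑ S ∈ I, prob p (fun f => ∃ q ∈ Finset.univ, ∃ c ∈ P S q, F S q c f) :=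
        prob_exists_le h0 h1' _ _
    _ ≤ ∑ S ∈ I, ∑ q, prob p (fun f => ∃ c ∈ P S q, F S q c f) :=
        Finset.sum_le_sum fun S _ => prob_exists_le h0 h1' _ _
    _ ≤ ∑ S ∈ I, ∑ q : Finset V × Finset V, (1 / 16 : ℝ) ^ n := by
        refine Finset.sum_le_sum fun S hS => Finset.sum_le_sum fun q _ => ?_
        refine (prob_exists_le h0 h1' _ _).trans
          ((Finset.sum_le_card_nsmul _ _ _ fun c hc => hF1 S q c hc).trans ?_)
        rw [nsmul_eq_mul]
        calc _ ≤ (S.card : ℝ) ^ n * Real.exp (-(κ * S.card / 32)) ^ n :=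
              mul_le_mul_of_nonneg_right (hPcard S hS q) (by positivity)
          _ = (S.card * Real.exp (-(κ * S.card / 32))) ^ n := by rw [mul_pow]
          _ ≤ _ := by
              gcongr
              exact hMκ _ (Finset.mem_filter.1 hS).2
    _ ≤ ∑ S : Finset V, ∑ q : Finset V × Finset V, (1 / 16 : ℝ) ^ n :=
        Finset.sum_le_sum_of_subset_of_nonneg (Finset.subset_univ _) fun _ _ _ => by positivity
    _ = (1 / 2) ^ n := by
        simp only [Finset.sum_const, Finset.card_univ, Fintype.card_prod, Fintype.card_finset,
          nsmul_eq_mul, ← hn]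
        push_cast
        rw [← mul_pow, ← mul_pow, ← mul_pow]
        norm_num

end LargeClasses

theorem mem_nonsingletons {V : Type*} [DecidableEq V] [Fintype V] {r : V → V} {u : V} :
    u ∈ nonsingletons r ↔ ∃ v, v ≠ u ∧ r v = r u := by
  simp [nonsingletons]

section Asymptotics

open Asymptotics in
theorem tendsto_threshold (c : ℝ) :
    Tendsto (fun n : ℕ => c * Real.log n / n) atTop (nhds 0) := by
  have h : Tendsto (fun x : ℝ => Real.log x / x) atTop (nhds 0) :=
    Real.isLittleO_log_id_atTop.tendsto_div_nhds_zero
  have h2 := (h.comp tendsto_natCast_atTop_atTop).const_mul c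
  simpa [Function.comp_def, mul_div_assoc] using h2

theorem tendsto_log_natCast : Tendsto (fun n : ℕ => Real.log n) atTop atTop :=
  Real.tendsto_log_atTop.comp tendsto_natCast_atTop_atTop

/-- If the three error terms are controlled, a random perturbation rarely has a nontrivial
equitable partition. -/
theorem prob_exists_equitable_le {n : ℕ} {p K δ κ η : ℝ} {M : ℕ} (hn : 0 < n) (h0 : 0 ≤ p)
    (h1 : p ≤ 1 / 2) (a : Sym2 (Fin n) → Bool) (hδ : 0 < δ) (hδ' : δ ≤ 1 / 2)
    (hsmall : Real.exp 1 * n * Real.exp (-(p * (1 - p) * (n - 2 * δ * n))) ≤ 1 / 2)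
    (hK : 1 ≤ K) (hc : ∀ b : ℕ, K ^ 2 * p * b ≤ 1 → (b : ℝ) ≤ δ * n / 4)
    (hη : 0 ≤ η)
    (h : ∀ u v : Fin n, u ≠ v → ∀ d,
      tiltedProb p 1 (flipSign a) (starAt u (Finset.univ \ {u, v})) d ≤ η)
    (hκ0 : 0 ≤ κ) (hκ : 1 / 2 + Real.exp (-(2 / K ^ 2)) / 2 ≤ Real.exp (-κ)) (hM : 2 ≤ M)
    (hMκ : ∀ k : ℕ, M ≤ k → k * Real.exp (-(κ * k / 32)) ≤ 1 / 16) (hKp : K ^ 2 * p ≤ 1 / 8) :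
    prob p (fun f => ∃ r : Fin n → Fin n, Equitable (flipBy a f) r ∧ ∃ u, r u ≠ u) ≤
      2 * (Real.exp 1 * n * Real.exp (-(p * (1 - p) * (n - 2 * δ * n)))) +
      (2 ^ n * 2 ^ n * Real.exp (-(p * (δ * n) ^ 2 / 32)) +
        n ^ n * 2 ^ n * K ^ (-(p * (δ * n) ^ 2 / 32))) +
      4 * M ^ 2 * (1 / n + η) + (1 / 2) ^ n := by
  have h1' : p ≤ 1 := by linarith
  have hn' : (0 : ℝ) < n := by exact_mod_cast hn
  have hM' : (0 : ℝ) < M := by exact_mod_cast (by omega : 0 < M)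
  have hV : 0 < Fintype.card (Fin n) := by simpa using hn
  have e1 := prob_small_nonsingletons_le h0 h1' a (2 * δ * n)
    (by simpa only [Fintype.card_fin] using hsmall)
  have e2 := prob_many_in_small_classes_le h0 h1' a (K := K) (δ := δ) hK
    (by rw [Fintype.card_fin]; positivity) (by simpa only [Fintype.card_fin] using hc)
  have e3 := sq_mul_prob_large_class_le h0 h1' a (x := n / (2 * M)) hη (by positivity) h
  have e4 := prob_few_in_small_classes_le hV h0 h1 a hK hκ0 hκ hM hMκ hKp
  simp only [Fintype.card_fin] at e1 e2 e3 e4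
  have e3' : prob p (fun f => ∃ r : Fin n → Fin n, Equitable (flipBy a f) r ∧
      ∃ w, n / (2 * M) < ((fiber r w).card : ℝ)) ≤ 4 * M ^ 2 * (1 / n + η) := by
    refine le_of_mul_le_mul_left (e3.trans (le_of_eq ?_))
      (show (0 : ℝ) < (n / (2 * M)) ^ 2 by positivity)
    field_simp
    ring
  refine (prob_mono h0 h1' ?_).trans <| (prob_or_le h0 h1' _ _).trans <|
    add_le_add ((prob_or_le h0 h1' _ _).trans <|
      add_le_add ((prob_or_le h0 h1' _ _).trans <| add_le_add e1 e2) e3') e4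
  rintro f ⟨r, hr, u, hu⟩
  by_cases hc1 : δ * n ≤ (nonreps r).card
  · by_cases hc2 : δ * n ≤ (inSmallClass p K r).card
    · exact Or.inl (Or.inl (Or.inr ⟨r, hr, hc1, hc2⟩))
    · by_cases hc3 : ∃ w, n / (2 * M) < ((fiber r w).card : ℝ)
      · exact Or.inl (Or.inr ⟨r, hr, hc3⟩)
      · push Not at hc2 hc3
        refine Or.inr ⟨r, hr, fun w => ?_, ?_⟩
        · have := hc3 w
          rw [le_div_iff₀ (by positivity)] at this
          have h2 : (2 * M * (fiber r w).card : ℝ) ≤ n := by linarith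
          exact_mod_cast h2
        · have h2 : (2 * (inSmallClass p K r).card : ℝ) ≤ n := by nlinarith
          exact_mod_cast h2
  · refine Or.inl (Or.inl (Or.inl ⟨r, hr, ⟨u, ?_⟩, ?_⟩))
    · exact mem_nonsingletons.2 ⟨r u, hu, hr.1 u⟩
    · have h2 : ((nonsingletons r).card : ℝ) ≤ 2 * (nonreps r).card := by
        exact_mod_cast card_nonsingletons_le r
      push Not at hc1
      linarith

theorem exists_mul_exp_le {κ : ℝ} (hκ : 0 < κ) : ∃ M : ℕ, 2 ≤ M ∧
    ∀ k : ℕ, M ≤ k → k * Real.exp (-(κ * k / 32)) ≤ 1 / 16 := by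
  have h := (Real.tendsto_pow_mul_exp_neg_atTop_nhds_zero 1).comp
    ((tendsto_natCast_atTop_atTop (R := ℝ)).const_mul_atTop (show 0 < κ / 32 by positivity))
  have h2 := h.eventually_le_const (show (0 : ℝ) < κ / 32 * (1 / 16) by positivity)
  obtain ⟨N, hN⟩ := eventually_atTop.1 h2
  refine ⟨max N 2, le_max_right _ _, fun k hk => ?_⟩
  have := hN k ((le_max_left _ _).trans hk)
  simp only [Function.comp_apply, pow_one] at this
  refine le_of_mul_le_mul_left ?_ (show 0 < κ / 32 by positivity)
  rw [← mul_assoc]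
  convert this using 4
  ring

set_option maxHeartbeats 800000 in
theorem eventually_prob_threshold_le {ε η : ℝ} (hε : 0 < ε) (hη : 0 < η) :
    ∀ᶠ n : ℕ in atTop, ∀ a : Sym2 (Fin n) → Bool,
      prob ((1 + ε) * Real.log n / n)
        (fun f => ∃ r : Fin n → Fin n, Equitable (flipBy a f) r ∧ ∃ u, r u ≠ u) ≤ η := by
  set δ := ε / (8 * (1 + ε)) with hδ
  have hδ0 : 0 < δ := by positivity
  have hδ1 : δ ≤ 1 / 2 := by
    rw [hδ, div_le_div_iff₀ (by positivity) (by norm_num)]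
    linarith
  have hδε : (1 + ε) * (1 - 2 * δ) = 1 + 3 * ε / 4 := by
    rw [hδ]
    field_simp
    ring
  set K := Real.exp (64 / δ ^ 2) with hK
  have hK1 : 1 ≤ K := Real.one_le_exp (by positivity)
  have hK0 : 0 < K := Real.exp_pos _
  set y := 1 / 2 + Real.exp (-(2 / K ^ 2)) / 2 with hy
  have hy0 : 0 < y := by positivity
  have hy1 : y < 1 := by
    have : Real.exp (-(2 / K ^ 2)) < 1 := Real.exp_lt_one_iff.2 (neg_lt_zero.2 (by positivity))
    rw [hy]
    linarith
  have hκ : 0 < -Real.log y := neg_pos.2 (Real.log_neg hy0 hy1)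
  obtain ⟨M, hM, hMκ⟩ := exists_mul_exp_le hκ
  have hM0 : (0 : ℝ) < M := by exact_mod_cast (by omega : 0 < M)
  obtain ⟨l, -, hl⟩ := exists_tiltedProb_one_le (show 0 < η / (32 * M ^ 2) by positivity)
  have hp := tendsto_threshold (1 + ε)
  have hL := tendsto_log_natCast
  filter_upwards [eventually_ge_atTop 1,
    tendsto_natCast_atTop_atTop.eventually_ge_atTop (32 * M ^ 2 / η),
    hp.eventually_le_const (show (0 : ℝ) < 1 / 2 by norm_num),
    hp.eventually_le_const (show (0 : ℝ) < 1 / (8 * K ^ 2) by positivity),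
    hp.eventually_le_const (show (0 : ℝ) < ε / 4 / (1 + 3 * ε / 4) by positivity),
    hL.eventually_ge_atTop (2 / ε * (1 - Real.log (1 / 2))),
    hL.eventually_ge_atTop (2 / ε * (1 - Real.log (η / 8))),
    hL.eventually_ge_atTop (1 / ((1 + ε) * δ ^ 2 / 32) *
      (2 * Real.log 2 + |Real.log (η / 8)|)),
    hL.eventually_ge_atTop (Real.log 2 + |Real.log (η / 8)|),
    hL.eventually_ge_atTop (4 / (K ^ 2 * (1 + ε) * δ)),
    hL.eventually_ge_atTop (l + 1),
    hL.eventually_ge_atTop 1,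
    (tendsto_pow_atTop_nhds_zero_of_lt_one (r := (1 / 2 : ℝ)) (by norm_num)
      (by norm_num)).eventually_le_const (show (0 : ℝ) < η / 4 by positivity)]
    with n hn hnM hp2 hpK hpε hL1 hL2 hL3 hL4 hL5 hL6 hL7 hpow a
  set L := Real.log n with hLdef
  set p := (1 + ε) * L / n with hpdef
  have hn0 : (0 : ℝ) < n := by exact_mod_cast hn
  have hn1 : (1 : ℝ) ≤ n := by exact_mod_cast hn
  have hpn : p * n = (1 + ε) * L := by
    rw [hpdef]
    field_simp
  have hp0 : 0 ≤ p := by positivity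
  have hexpL : Real.exp L = n := Real.exp_log hn0
  have t1 : ∀ θ : ℝ, 0 < θ → 2 / ε * (1 - Real.log θ) ≤ L →
      Real.exp 1 * n * Real.exp (-(p * (1 - p) * (n - 2 * δ * n))) ≤ θ := by
    intro θ hθ hθL
    rw [← hexpL, ← Real.exp_add, ← Real.exp_add, ← Real.le_log_iff_exp_le hθ, hexpL]
    have e1 : p * (1 - p) * (n - 2 * δ * n) = L * ((1 + 3 * ε / 4) * (1 - p)) := by
      rw [← hδε]
      linear_combination (1 - p) * (1 - 2 * δ) * hpn
    rw [le_div_iff₀ (by positivity)] at hpε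
    have e2 : 1 + ε / 2 ≤ (1 + 3 * ε / 4) * (1 - p) := by linarith
    have e3 : L * (1 + ε / 2) ≤ L * ((1 + 3 * ε / 4) * (1 - p)) :=
      mul_le_mul_of_nonneg_left e2 (by linarith)
    rw [div_mul_eq_mul_div, div_le_iff₀ hε] at hθL
    rw [e1]
    linarith
  have hexp : p * (δ * n) ^ 2 / 32 = n * ((1 + ε) * δ ^ 2 / 32 * L) := by
    linear_combination δ ^ 2 * n / 32 * hpn
  have hpow2 : (2 : ℝ) ^ n = Real.exp (n * Real.log 2) := by
    rw [Real.exp_nat_mul, Real.exp_log two_pos]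
  have hpown : (n : ℝ) ^ n = Real.exp (n * L) := by rw [Real.exp_nat_mul, hexpL]
  have habs : -|Real.log (η / 8)| ≤ Real.log (η / 8) := neg_abs_le _
  have habs0 := abs_nonneg (Real.log (η / 8))
  have t2 : (2 : ℝ) ^ n * 2 ^ n * Real.exp (-(p * (δ * n) ^ 2 / 32)) ≤ η / 8 := by
    rw [hpow2, ← Real.exp_add, ← Real.exp_add, ← Real.le_log_iff_exp_le (by positivity), hexp]
    rw [div_mul_eq_mul_div, div_le_iff₀ (by positivity)] at hL3
    have : |Real.log (η / 8)| ≤ n * ((1 + ε) * δ ^ 2 / 32 * L - 2 * Real.log 2) := by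
      have h3 : |Real.log (η / 8)| ≤ (1 + ε) * δ ^ 2 / 32 * L - 2 * Real.log 2 := by linarith
      exact h3.trans (le_mul_of_one_le_left (habs0.trans h3) hn1)
    linarith
  have t3 : (n : ℝ) ^ n * 2 ^ n * K ^ (-(p * (δ * n) ^ 2 / 32)) ≤ η / 8 := by
    rw [hpow2, hpown, hK, ← Real.exp_mul, ← Real.exp_add, ← Real.exp_add,
      ← Real.le_log_iff_exp_le (by positivity), hexp]
    have h3 : 64 / δ ^ 2 * -(n * ((1 + ε) * δ ^ 2 / 32 * L)) = -(2 * (1 + ε) * (n * L)) := by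
      field_simp
      ring
    rw [h3]
    have h4 : |Real.log (η / 8)| ≤ n * (L - Real.log 2) := by
      have h3 : |Real.log (η / 8)| ≤ L - Real.log 2 := by linarith
      exact h3.trans (le_mul_of_one_le_left (habs0.trans h3) hn1)
    have h5 : 0 ≤ ε * (n * L) := by positivity
    linarith
  have t4 : 4 * (M : ℝ) ^ 2 * (1 / n + η / (32 * M ^ 2)) ≤ η / 4 := by
    have h3 : 1 / (n : ℝ) ≤ η / (32 * M ^ 2) := by
      rw [div_le_div_iff₀ hn0 (by positivity)]
      rw [div_le_iff₀ hη] at hnM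
      linarith
    calc 4 * (M : ℝ) ^ 2 * (1 / n + η / (32 * M ^ 2))
        ≤ 4 * (M : ℝ) ^ 2 * (η / (32 * M ^ 2) + η / (32 * M ^ 2)) := by gcongr
      _ = η / 4 := by
        field_simp
        norm_num
  refine (prob_exists_equitable_le hn hp0 hp2 a hδ0 hδ1 (t1 _ (by norm_num) hL1) hK1 ?_
    (show 0 ≤ η / (32 * M ^ 2) by positivity) ?_ hκ.le ?_ hM hMκ ?_).trans ?_
  · intro b hb
    rw [div_le_iff₀ (by positivity)] at hL5
    have h3 : K ^ 2 * (1 + ε) * L * b ≤ n := by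
      have : K ^ 2 * (1 + ε) * L * b = K ^ 2 * p * b * n := by
        linear_combination -K ^ 2 * b * hpn
      rw [this]
      exact mul_le_of_le_one_left hn0.le hb
    have h4 : 4 * (b : ℝ) ≤ L * (K ^ 2 * (1 + ε) * δ) * b :=
      mul_le_mul_of_nonneg_right hL5 (Nat.cast_nonneg b)
    have h5 : δ * (K ^ 2 * (1 + ε) * L * b) ≤ δ * n := mul_le_mul_of_nonneg_left h3 hδ0.le
    linarith
  · intro u v huv d
    refine hl p hp0 hp2 _ (flipSign_eq a) _ ?_ d
    rw [card_star, Finset.card_sdiff_of_subset (Finset.subset_univ _), Finset.card_pair huv,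
      Finset.card_univ, Fintype.card_fin]
    have h3 : (n : ℝ) - 2 ≤ ((n - 2 : ℕ) : ℝ) := by
      have : n ≤ n - 2 + 2 := by omega
      have : (n : ℝ) ≤ (n - 2 : ℕ) + 2 := by exact_mod_cast this
      linarith
    have h4 := mul_le_mul_of_nonneg_left h3 hp0
    have h5 : 0 ≤ ε * L := by positivity
    linarith
  · rw [neg_neg, Real.exp_log hy0]
  · rw [le_div_iff₀ (by positivity)] at hpK
    linarith
  · have := t1 _ (by positivity) hL2
    linarith

theorem eventually_prob_le {ε η : ℝ} (hε : 0 < ε) (hη : 0 < η) :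
    ∀ᶠ n : ℕ in atTop, ∀ p : ℝ, (1 + ε) * Real.log n / n ≤ p → p ≤ 1 / 2 →
      ∀ a : Sym2 (Fin n) → Bool,
      prob p (fun f => ∃ r : Fin n → Fin n, Equitable (flipBy a f) r ∧ ∃ u, r u ≠ u) ≤ η := by
  filter_upwards [eventually_prob_threshold_le hε hη,
    (tendsto_threshold (1 + ε)).eventually_lt_const (show (0 : ℝ) < 1 / 2 by norm_num)]
    with n hn hlt p hp hp2 a
  have hL : 0 ≤ Real.log n := Real.log_natCast_nonneg n
  set r := (1 + ε) * Real.log n / n with hr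
  have hr0 : 0 ≤ r := by positivity
  have h2 : 0 < 1 - 2 * r := by linarith
  set q := (p - r) / (1 - 2 * r) with hq
  have hq0 : 0 ≤ q := div_nonneg (by linarith) h2.le
  have hq1 : q ≤ 1 := by
    rw [hq, div_le_one h2]
    linarith
  have hpq : p = q * (1 - r) + r * (1 - q) := by
    have : q * (1 - 2 * r) = p - r := div_mul_cancel₀ _ h2.ne'
    linarith
  rw [hpq, prob, ← expect_xor]
  refine (expect_mono hq0 hq1 (Y := fun _ => η) fun g => ?_).trans (expect_const η).le
  refine le_trans (le_of_eq ?_) (hn (flipBy a g))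
  rw [prob]
  congr 1
  funext f
  have : flipBy a (fun i => xor (g i) (f i)) = flipBy (flipBy a g) f := by
    funext e
    simp only [flipBy, Bool.xor_assoc]
  rw [this]

end Asymptotics

theorem erdosRenyiMeasure_eq_ofReal_prob {n : ℕ} {p : ℝ} (h0 : 0 ≤ p) (h1 : p ≤ 1)
    (E : (Sym2 (Fin n) → Bool) → Prop) :
    erdosRenyiMeasure n p {f | E f} = ENNReal.ofReal (prob p E) := by
  classical
  rw [prob, expect, ENNReal.ofReal_sum_of_nonneg fun f _ =>
    mul_nonneg (weight_nonneg h0 h1 f) (by split_ifs <;> norm_num), erdosRenyiMeasure,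
    bernoulliProduct, Measure.finsetSum_apply]
  refine Finset.sum_congr rfl fun f _ => ?_
  rw [Measure.smul_apply, Measure.dirac_apply' _ (Set.toFinite _).measurableSet, smul_eq_mul,
    ENNReal.ofReal_mul (weight_nonneg h0 h1 f), weight, ENNReal.ofReal_prod_of_nonneg fun i _ => by
      split_ifs <;> linarith]
  congr 1
  · exact Finset.prod_congr rfl fun i _ => by split_ifs <;> rfl
  · by_cases hE : E f <;> simp [hE]

end ColourRefinement

/-- smoothed colour refinement, Theorem 1.2.
For fixed `ε > 0` and any `p = p_n ∈ [0,1/2]` with (eventually) `p ≥ (1+ε)·log n / n`,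
and any sequence of graphs `G₀` on `{1,…,n}`, whp colour refinement started from the trivial
colouring assigns pairwise distinct colours to all vertices of `G₀ △ G_rand`. -/
theorem stmt0 (ε : ℝ) (hε : 0 < ε) (p : ℕ → ℝ)
    (hp0 : ∀ n, 0 ≤ p n) (hp1 : ∀ n, p n ≤ 1 / 2)
    (hlb : ∀ᶠ n : ℕ in atTop, (1 + ε) * Real.log n / n ≤ p n)
    (G₀ : (n : ℕ) → SimpleGraph (Fin n)) :
    Tendsto (fun n : ℕ =>
      erdosRenyiMeasure n (p n)
        {f | ∀ u v : Fin n,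
          crStableTrivial (symmDiffG (G₀ n) (graphOfFlip f)) u v → u = v})
      atTop (nhds 1) := by
  classical
  have hp1' : ∀ n, p n ≤ 1 := fun n => (hp1 n).trans (by norm_num)
  simp only [ColourRefinement.erdosRenyiMeasure_eq_ofReal_prob (hp0 _) (hp1' _)]
  rw [← ENNReal.ofReal_one]
  refine ENNReal.tendsto_ofReal (Metric.tendsto_nhds.2 fun η hη => ?_)
  filter_upwards [hlb, ColourRefinement.eventually_prob_le hε (half_pos hη)] with n hn hb
  set Good : (Sym2 (Fin n) → Bool) → Prop := fun f =>
    ∀ u v : Fin n, crStableTrivial (symmDiffG (G₀ n) (graphOfFlip f)) u v → u = v with hGood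
  have h1 := ColourRefinement.prob_not (p := p n) Good
  have h2 := ColourRefinement.prob_nonneg (hp0 n) (hp1' n) fun f => ¬ Good f
  have h3 := (ColourRefinement.prob_mono (hp0 n) (hp1' n) fun f (hf : ¬ Good f) =>
    ColourRefinement.exists_equitable hf).trans (hb (p n) hn (hp1 n) _)
  rw [Real.dist_eq, abs_lt]
  constructor <;> linarith
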